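/- If the R-order Λ is of bounded lattice type, i.e., there is an integer b > 0 such that every indecomposable Λ-lattice M satisfies l_R(h(M)) < b, then Λ is of finite lat-type, i.e., there are only finitely many isomorphism classes of indecomposable Λ-lattices. -/

import Mathlib

universe u

open IsLocalRing

noncomputable section

namespace BT

/-- The length of a module, defined as the Krull dimension of its lattice of
submodules (which agrees with the usual composition-series length). -/
def moduleLength (A : Type u) [Ring A] (M : Type u) [AddCommGroup M] [Module A M] :
    WithBot ℕ∞ :=
  Order.krullDim (Submodule A M)

/-- `M` is a maximal Cohen-Macaulay module over the local ring `R`: it admits an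
`M`-regular sequence contained in the maximal ideal whose length is `dim R`
(i.e. `depth_R M = dim R`). -/
def IsMCM (R : Type u) [CommRing R] [IsLocalRing R]
    (M : Type u) [AddCommGroup M] [Module R M] : Prop :=
  ∃ rs : List R, (∀ r ∈ rs, r ∈ maximalIdeal R) ∧ RingTheory.Sequence.IsRegular M rs ∧
    (rs.length : WithBot ℕ∞) = ringKrullDim R

/-- The `n`-th Ext group of two `R`-modules. -/
def extGroup (R : Type u) [CommRing R] (n : ℕ)
    (A B : Type u) [AddCommGroup A] [Module R A] [AddCommGroup B] [Module R B] : Type u :=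
  ((Ext R (ModuleCat.{u} R) n).obj (Opposite.op (ModuleCat.of R A))).obj (ModuleCat.of R B)

instance (R : Type u) [CommRing R] (n : ℕ)
    (A B : Type u) [AddCommGroup A] [Module R A] [AddCommGroup B] [Module R B] :
    AddCommGroup (extGroup R n A B) :=
  inferInstanceAs (AddCommGroup
    (((Ext R (ModuleCat.{u} R) n).obj (Opposite.op (ModuleCat.of R A))).obj (ModuleCat.of R B)))

instance (R : Type u) [CommRing R] (n : ℕ)
    (A B : Type u) [AddCommGroup A] [Module R A] [AddCommGroup B] [Module R B] :
    Module R (extGroup R n A B) :=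
  inferInstanceAs (Module R
    (((Ext R (ModuleCat.{u} R) n).obj (Opposite.op (ModuleCat.of R A))).obj (ModuleCat.of R B)))

/-- `ω` is a canonical module for the Cohen-Macaulay local ring `R`: it is a
finitely generated module with `Ext^i_R(k, ω) = 0` for `i ≠ dim R` and
`Ext^{dim R}_R(k, ω) ≅ k`. -/
def IsCanonicalModule (R : Type u) [CommRing R] [IsLocalRing R]
    (ω : Type u) [AddCommGroup ω] [Module R ω] : Prop :=
  Module.Finite R ω ∧ ∃ d : ℕ, (d : WithBot ℕ∞) = ringKrullDim R ∧
    (∀ i : ℕ, i ≠ d → Subsingleton (extGroup R i (ResidueField R) ω)) ∧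
    Nonempty (extGroup R d (ResidueField R) ω ≃ₗ[R] ResidueField R)

/-- A homomorphism of `Λ`-modules factors through a projective `Λ`-module. -/
def FactorsThroughProjective (Λ : Type u) [Ring Λ] {M N : Type u}
    [AddCommGroup M] [Module Λ M] [AddCommGroup N] [Module Λ N] (f : M →ₗ[Λ] N) : Prop :=
  ∃ (P : Type u) (_ : AddCommGroup P) (_ : Module Λ P), Module.Projective Λ P ∧
    ∃ (g : M →ₗ[Λ] P) (h : P →ₗ[Λ] N), h.comp g = f

section StableHom

variable (R : Type u) [CommRing R] (Λ : Type u) [Ring Λ] [Algebra R Λ]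
variable (M N : Type u) [AddCommGroup M] [Module Λ M]
  [AddCommGroup N] [Module Λ N] [Module R N] [IsScalarTower R Λ N]

/-- The `R`-submodule of `Hom_Λ(M, N)` consisting of the homomorphisms that
factor through a projective `Λ`-module. -/
def projTrivial : Submodule R (M →ₗ[Λ] N) where
  carrier := {f | FactorsThroughProjective Λ f}
  zero_mem' := ⟨Λ, inferInstance, inferInstance, inferInstance, 0, 0, by ext; simp⟩
  add_mem' := by
    rintro f₁ f₂ ⟨P₁, _, _, hP₁, g₁, h₁, rfl⟩ ⟨P₂, _, _, hP₂, g₂, h₂, rfl⟩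
    exact ⟨P₁ × P₂, inferInstance, inferInstance, inferInstance,
      g₁.prod g₂, h₁.comp (LinearMap.fst Λ P₁ P₂) + h₂.comp (LinearMap.snd Λ P₁ P₂),
      by ext m; simp⟩
  smul_mem' := by
    rintro r f ⟨P, _, _, hP, g, h, rfl⟩
    exact ⟨P, inferInstance, inferInstance, hP, g, r • h, by ext m; simp⟩

/-- The stable Hom `Hom-bar_Λ(M, N)`: homomorphisms modulo those factoring
through projectives, as an `R`-module. -/
def stableHom : Type u := (M →ₗ[Λ] N) ⧸ projTrivial R Λ M N

instance : AddCommGroup (stableHom R Λ M N) :=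
  inferInstanceAs (AddCommGroup ((M →ₗ[Λ] N) ⧸ projTrivial R Λ M N))

instance : Module R (stableHom R Λ M N) :=
  inferInstanceAs (Module R ((M →ₗ[Λ] N) ⧸ projTrivial R Λ M N))

end StableHom

/-- The `h`-length of `M` (relative to a fixed module `G`): the length over `R`
of `h(M) = Hom-bar_Λ(M, M ⊕ G)`. -/
def hLength (R : Type u) [CommRing R] (Λ : Type u) [Ring Λ] [Algebra R Λ]
    (M : Type u) [AddCommGroup M] [Module Λ M] [Module R M] [IsScalarTower R Λ M]
    (G : Type u) [AddCommGroup G] [Module Λ G] [Module R G] [IsScalarTower R Λ G] :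
    WithBot ℕ∞ :=
  moduleLength R (stableHom R Λ M (M × G))

/-- A module is indecomposable if it is nonzero and admits no nontrivial direct
sum decomposition. -/
def IsIndecomposable (Λ : Type u) [Ring Λ] (M : Type u) [AddCommGroup M] [Module Λ M] : Prop :=
  Nontrivial M ∧ ∀ A B : Submodule Λ M, IsCompl A B → A = ⊥ ∨ B = ⊥

/-- `Ext¹_Λ(M, Y) = 0`, expressed by the splitting of extensions: every
surjection onto `M` with kernel isomorphic to `Y` splits. -/
def Ext1Vanishes (Λ : Type u) [Ring Λ] (M Y : Type u)
    [AddCommGroup M] [Module Λ M] [AddCommGroup Y] [Module Λ Y] : Prop :=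
  ∀ (E : Type u) (_ : AddCommGroup E) (_ : Module Λ E) (g : E →ₗ[Λ] M),
    Function.Surjective g → Nonempty ((LinearMap.ker g) ≃ₗ[Λ] Y) →
      ∃ s : M →ₗ[Λ] E, g.comp s = LinearMap.id

/-- A homomorphism `f : X → C` is right minimal if every endomorphism `g` of `X`
with `f ∘ g = f` is an isomorphism. -/
def RightMinimal (Λ : Type u) [Ring Λ] {X C : Type u} [AddCommGroup X] [Module Λ X]
    [AddCommGroup C] [Module Λ C] (f : X →ₗ[Λ] C) : Prop :=
  ∀ g : X →ₗ[Λ] X, f.comp g = f → Function.Bijective g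

/-- Multiplication by `s ∈ R` on `M` lifts along `g : E → M`. -/
def SmulLiftsAlong (R : Type u) [CommRing R] (Λ : Type u) [Ring Λ] [Algebra R Λ]
    {E M : Type u} [AddCommGroup E] [Module Λ E] [AddCommGroup M] [Module Λ M]
    (s : R) (g : E →ₗ[Λ] M) : Prop :=
  ∃ h : M →ₗ[Λ] E, ∀ m, g (h m) = algebraMap R Λ s • m

/-- The localization `M_p` of the finitely generated `Λ`-module `M` is a
projective `Λ_p`-module.  (For a finitely generated module over a noetherian
algebra this is equivalent to the following lifting property: for every
surjection of `Λ`-modules onto `M`, multiplication by some `s ∉ p` lifts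
along it.) -/
def LocallyProjectiveAt (R : Type u) [CommRing R] (Λ : Type u) [Ring Λ] [Algebra R Λ]
    (p : Ideal R) (M : Type u) [AddCommGroup M] [Module Λ M] : Prop :=
  ∀ (E : Type u) (_ : AddCommGroup E) (_ : Module Λ E) (g : E →ₗ[Λ] M),
    Function.Surjective g → ∃ s ∉ p, SmulLiftsAlong R Λ s g

/-- The action of `a : Λ` on a `Λ`-module `M`, as an `R`-linear map. -/
def actionMap (R : Type u) [CommRing R] (Λ : Type u) [Ring Λ] [Algebra R Λ]
    (M : Type u) [AddCommGroup M] [Module Λ M] [Module R M] [IsScalarTower R Λ M]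
    (a : Λ) : M →ₗ[R] M where
  toFun m := a • m
  map_add' := smul_add a
  map_smul' r m := smul_comm a r m

/-- For a left `Λ`-module `M`, the module `Hom_R(M, ω)` is a right `Λ`-module,
i.e. a left `Λᵐᵒᵖ`-module, via `(aᵒᵖ • f) m = f (a • m)`. -/
instance omegaDualModule (R : Type u) [CommRing R] (Λ : Type u) [Ring Λ] [Algebra R Λ]
    (ω : Type u) [AddCommGroup ω] [Module R ω]
    (M : Type u) [AddCommGroup M] [Module Λ M] [Module R M] [IsScalarTower R Λ M] :
    Module Λᵐᵒᵖ (M →ₗ[R] ω) where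
  smul a f := f.comp (actionMap R Λ M a.unop)
  one_smul f := LinearMap.ext fun m => congrArg f (one_smul Λ m)
  mul_smul a b f := LinearMap.ext fun m => congrArg f (mul_smul b.unop a.unop m)
  smul_zero _ := LinearMap.ext fun _ => rfl
  smul_add _ _ _ := LinearMap.ext fun _ => rfl
  add_smul a b f := LinearMap.ext fun m => by
    show f ((a.unop + b.unop) • m) = f (a.unop • m) + f (b.unop • m)
    rw [add_smul, map_add]
  zero_smul f := LinearMap.ext fun m => by
    show f ((0 : Λ) • m) = 0
    rw [zero_smul, map_zero]

/-- `M` is a `Λ`-lattice: it is finitely generated, maximal Cohen-Macaulay as an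
`R`-module, `M_p` is `Λ_p`-projective for every non-maximal prime `p`, and
`Hom_R(M, ω)_p` is `Λ_p^op`-projective for every non-maximal prime `p`. -/
def IsLattice (R : Type u) [CommRing R] [IsLocalRing R]
    (Λ : Type u) [Ring Λ] [Algebra R Λ]
    (ω : Type u) [AddCommGroup ω] [Module R ω]
    (M : Type u) [AddCommGroup M] [Module Λ M] [Module R M] [IsScalarTower R Λ M] : Prop :=
  Module.Finite Λ M ∧ IsMCM R M ∧
    (∀ p : Ideal R, p.IsPrime → p ≠ maximalIdeal R → LocallyProjectiveAt R Λ p M) ∧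
    (∀ p : Ideal R, p.IsPrime → p ≠ maximalIdeal R →
      LocallyProjectiveAt R Λᵐᵒᵖ p (M →ₗ[R] ω))

/-- `Y` is a lat-injective module: it is a lattice and `Ext¹_Λ(M, Y) = 0` for
every `Λ`-lattice `M`. -/
def IsLatInjective (R : Type u) [CommRing R] [IsLocalRing R]
    (Λ : Type u) [Ring Λ] [Algebra R Λ]
    (ω : Type u) [AddCommGroup ω] [Module R ω]
    (Y : Type u) [AddCommGroup Y] [Module Λ Y] [Module R Y] [IsScalarTower R Λ Y] : Prop :=
  IsLattice R Λ ω Y ∧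
    ∀ (M : Type u) (_ : AddCommGroup M) (_ : Module Λ M) (_ : Module R M)
      (_ : IsScalarTower R Λ M), IsLattice R Λ ω M → Ext1Vanishes Λ M Y

/-- `Y` admits a finite resolution `0 → L_t → ⋯ → L_0 → Y → 0` by lat-injective
modules. -/
def HasLatInjResOfLength (R : Type u) [CommRing R] [IsLocalRing R]
    (Λ : Type u) [Ring Λ] [Algebra R Λ]
    (ω : Type u) [AddCommGroup ω] [Module R ω] :
    ℕ → ∀ (Y : Type u) [AddCommGroup Y] [Module Λ Y] [Module R Y] [IsScalarTower R Λ Y], Prop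
  | 0, Y, _, _, _, _ => IsLatInjective R Λ ω Y
  | (t + 1), Y, _, _, _, _ =>
      ∃ (L : Type u) (_ : AddCommGroup L) (_ : Module Λ L) (_ : Module R L)
        (_ : IsScalarTower R Λ L) (π : L →ₗ[Λ] Y), IsLatInjective R Λ ω L ∧
          Function.Surjective π ∧ HasLatInjResOfLength R Λ ω t (LinearMap.ker π)

/-- `α : X → C` is a minimal lat-approximation of the `Λ`-module `C`: `X` is a
lattice, `α` is surjective and right minimal, and its kernel admits a finite
resolution by lat-injectives. -/
def IsMinimalLatApprox (R : Type u) [CommRing R] [IsLocalRing R]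
    (Λ : Type u) [Ring Λ] [Algebra R Λ] (ω : Type u) [AddCommGroup ω] [Module R ω]
    {X : Type u} [AddCommGroup X] [Module Λ X] [Module R X] [IsScalarTower R Λ X]
    {C : Type u} [AddCommGroup C] [Module Λ C] (α : X →ₗ[Λ] C) : Prop :=
  IsLattice R Λ ω X ∧ Function.Surjective α ∧
    (∃ t : ℕ, HasLatInjResOfLength R Λ ω t (LinearMap.ker α)) ∧ RightMinimal Λ α

/-- `Sfam` is a complete set of pairwise non-isomorphic simple `Λ`-modules, and
`α : G → S` is a minimal lat-approximation of their direct sum `S = ⨁ i, Sfam i`. -/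
def IsSimplesApprox (R : Type u) [CommRing R] [IsLocalRing R]
    (Λ : Type u) [Ring Λ] [Algebra R Λ] (ω : Type u) [AddCommGroup ω] [Module R ω]
    (ι : Type u) [Fintype ι] (Sfam : ι → Type u) [∀ i, AddCommGroup (Sfam i)]
    [∀ i, Module Λ (Sfam i)]
    (G : Type u) [AddCommGroup G] [Module Λ G] [Module R G] [IsScalarTower R Λ G]
    (α : G →ₗ[Λ] ∀ i, Sfam i) : Prop :=
  (∀ i, IsSimpleModule Λ (Sfam i)) ∧
  (∀ i j, i ≠ j → IsEmpty (Sfam i ≃ₗ[Λ] Sfam j)) ∧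
  (∀ (T : Type u) (_ : AddCommGroup T) (_ : Module Λ T),
      IsSimpleModule Λ T → ∃ i, Nonempty (T ≃ₗ[Λ] Sfam i)) ∧
  IsMinimalLatApprox R Λ ω α

/-- There are infinitely many pairwise non-isomorphic indecomposable
`Λ`-lattices of `h`-length `t`. -/
def InfManyIndecLatticesOfHLength (R : Type u) [CommRing R] [IsLocalRing R]
    (Λ : Type u) [Ring Λ] [Algebra R Λ] (ω : Type u) [AddCommGroup ω] [Module R ω]
    (G : Type u) [AddCommGroup G] [Module Λ G] [Module R G] [IsScalarTower R Λ G]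
    (t : ℕ) : Prop :=
  ∃ (F : ℕ → Type u) (_ : ∀ n, AddCommGroup (F n)) (_ : ∀ n, Module Λ (F n))
    (_ : ∀ n, Module R (F n)) (_ : ∀ n, IsScalarTower R Λ (F n)),
    (∀ n, IsLattice R Λ ω (F n) ∧ IsIndecomposable Λ (F n) ∧
      hLength R Λ (F n) G = (t : WithBot ℕ∞)) ∧
    ∀ m n : ℕ, m ≠ n → IsEmpty (F m ≃ₗ[Λ] F n)

/-- `Λ` has strongly unbounded lattice type: there is an infinite strictly
increasing sequence `b 0 < b 1 < ⋯` of integers such that for each `i` there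
are infinitely many pairwise non-isomorphic indecomposable `Λ`-lattices of
`h`-length `b i`. -/
def StronglyUnboundedLatType (R : Type u) [CommRing R] [IsLocalRing R]
    (Λ : Type u) [Ring Λ] [Algebra R Λ] (ω : Type u) [AddCommGroup ω] [Module R ω]
    (G : Type u) [AddCommGroup G] [Module Λ G] [Module R G] [IsScalarTower R Λ G] : Prop :=
  ∃ b : ℕ → ℕ, StrictMono b ∧ ∀ i, InfManyIndecLatticesOfHLength R Λ ω G (b i)

/-- `Λ` is of finite lattice type: there are only finitely many isomorphism
classes of indecomposable `Λ`-lattices. -/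
def FiniteLatType (R : Type u) [CommRing R] [IsLocalRing R]
    (Λ : Type u) [Ring Λ] [Algebra R Λ] (ω : Type u) [AddCommGroup ω] [Module R ω] : Prop :=
  ∃ (n : ℕ) (F : Fin n → Type u) (_ : ∀ i, AddCommGroup (F i)) (_ : ∀ i, Module Λ (F i)),
    ∀ (M : Type u) (_ : AddCommGroup M) (_ : Module Λ M) (_ : Module R M)
      (_ : IsScalarTower R Λ M), IsLattice R Λ ω M → IsIndecomposable Λ M →
        ∃ i, Nonempty (M ≃ₗ[Λ] F i)

set_option linter.unusedSectionVars false

section ProjectiveFactorization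

variable {R : Type u} [CommRing R] {Λ : Type u} [Ring Λ] [Algebra R Λ]
variable {M N X Y : Type u} [AddCommGroup M] [Module Λ M] [AddCommGroup N] [Module Λ N]
  [AddCommGroup X] [Module Λ X] [AddCommGroup Y] [Module Λ Y]

namespace FactorsThroughProjective

lemma postcomp {f : M →ₗ[Λ] N} (hf : FactorsThroughProjective Λ f) (g : N →ₗ[Λ] X) :
    FactorsThroughProjective Λ (g.comp f) := by
  obtain ⟨P, _, _, hP, a, c, rfl⟩ := hf
  exact ⟨P, inferInstance, inferInstance, hP, a, g.comp c, by rw [LinearMap.comp_assoc]⟩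

lemma precomp {f : M →ₗ[Λ] N} (hf : FactorsThroughProjective Λ f) (g : X →ₗ[Λ] M) :
    FactorsThroughProjective Λ (f.comp g) := by
  obtain ⟨P, _, _, hP, a, c, rfl⟩ := hf
  exact ⟨P, inferInstance, inferInstance, hP, a.comp g, c, by rw [LinearMap.comp_assoc]⟩

lemma zero : FactorsThroughProjective Λ (0 : M →ₗ[Λ] N) :=
  ⟨Λ, inferInstance, inferInstance, inferInstance, 0, 0, by simp⟩

lemma add {f g : M →ₗ[Λ] N} (hf : FactorsThroughProjective Λ f)
    (hg : FactorsThroughProjective Λ g) : FactorsThroughProjective Λ (f + g) := by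
  obtain ⟨P, _, _, _, a, c, rfl⟩ := hf
  obtain ⟨Q, _, _, _, a', c', rfl⟩ := hg
  exact ⟨P × Q, inferInstance, inferInstance, inferInstance,
    a.prod a', c.comp (LinearMap.fst Λ P Q) + c'.comp (LinearMap.snd Λ P Q), by ext m; simp⟩

lemma sum {ι : Type*} (s : Finset ι) (f : ι → M →ₗ[Λ] N)
    (hf : ∀ i ∈ s, FactorsThroughProjective Λ (f i)) :
    FactorsThroughProjective Λ (∑ i ∈ s, f i) := by
  classical
  induction s using Finset.induction_on with
  | empty => simpa using zero
  | insert i s hi ih =>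
    rw [Finset.sum_insert hi]
    exact (hf i (Finset.mem_insert_self i s)).add
      (ih fun j hj => hf j (Finset.mem_insert_of_mem hj))

lemma lift {f : M →ₗ[Λ] N} (hf : FactorsThroughProjective Λ f) (π : X →ₗ[Λ] N)
    (hπ : Function.Surjective π) :
    ∃ g : M →ₗ[Λ] X, FactorsThroughProjective Λ g ∧ π.comp g = f := by
  obtain ⟨P, _, _, hP, a, c, rfl⟩ := hf
  obtain ⟨c', hc'⟩ := Module.projective_lifting_property π c hπ
  exact ⟨c'.comp a, ⟨P, inferInstance, inferInstance, hP, a, c', rfl⟩, by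
    rw [← LinearMap.comp_assoc, hc']⟩

lemma of_projective_left [Module.Projective Λ M] (f : M →ₗ[Λ] N) :
    FactorsThroughProjective Λ f :=
  ⟨M, inferInstance, inferInstance, inferInstance, LinearMap.id, f, by simp⟩

/-- A map factoring through a projective module factors through a free module. -/
lemma exists_free {f : M →ₗ[Λ] N} (hf : FactorsThroughProjective Λ f) :
    ∃ (κ : Type u) (c : M →ₗ[Λ] (κ →₀ Λ)) (e : κ → N),
      ∀ m, f m = Finsupp.linearCombination Λ e (c m) := by
  obtain ⟨P, _, _, hP, a, c, rfl⟩ := hf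
  obtain ⟨s, hs⟩ := hP.out
  refine ⟨P, s.comp a, c, fun m => ?_⟩
  have := congrArg c (hs (a m))
  rw [LinearMap.comp_apply, ← this, LinearMap.comp_apply]
  simp [Finsupp.linearCombination_apply, Finsupp.sum, map_sum]

end FactorsThroughProjective

lemma projective_of_factorsThroughProjective_id
    (h : FactorsThroughProjective Λ (LinearMap.id : M →ₗ[Λ] M)) : Module.Projective Λ M := by
  obtain ⟨P, _, _, hP, a, c, hac⟩ := h
  exact Module.Projective.of_split a c hac

lemma locallyProjectiveAt_iff {p : Ideal R} :
    LocallyProjectiveAt R Λ p M ↔ ∃ s ∉ p, ∃ f : M →ₗ[Λ] M,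
      FactorsThroughProjective Λ f ∧ ∀ m, f m = algebraMap R Λ s • m := by
  constructor
  · intro h
    obtain ⟨s, hs, a, ha⟩ := h (M →₀ Λ) inferInstance inferInstance
      (Finsupp.linearCombination Λ (id : M → M)) (Finsupp.linearCombination_id_surjective Λ M)
    exact ⟨s, hs, (Finsupp.linearCombination Λ (id : M → M)).comp a,
      ⟨_, inferInstance, inferInstance, inferInstance, a, _, rfl⟩, ha⟩
  · rintro ⟨s, hs, f, hf, hfs⟩ E _ _ g hg
    obtain ⟨f', -, hf'⟩ := hf.lift g hg
    exact ⟨s, hs, f', fun m => by rw [← hfs, ← hf']; rfl⟩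

lemma locallyProjectiveAt_of_maps {p : Ideal R} (hp : p.IsPrime) {s : R} (hs : s ∉ p)
    (b₁ : M →ₗ[Λ] X) (a₁ : X →ₗ[Λ] M) (b₂ : M →ₗ[Λ] Y) (a₂ : Y →ₗ[Λ] M)
    (h : ∀ m, algebraMap R Λ s • m = a₁ (b₁ m) + a₂ (b₂ m))
    (hX : LocallyProjectiveAt R Λ p X) (hY : LocallyProjectiveAt R Λ p Y) :
    LocallyProjectiveAt R Λ p M := by
  rw [locallyProjectiveAt_iff] at *
  obtain ⟨t, ht, f, hf, hft⟩ := hX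
  obtain ⟨t', ht', f', hf', hft'⟩ := hY
  have comm (r r' : R) (m : M) : algebraMap R Λ r • algebraMap R Λ r' • m
      = algebraMap R Λ r' • algebraMap R Λ r • m := by
    simp only [smul_smul, ← map_mul, mul_comm]
  let c (t : R) : M →ₗ[Λ] M :=
    { toFun := fun m => algebraMap R Λ t • m
      map_add' := smul_add _
      map_smul' := fun a m => by simp only [smul_smul, RingHom.id_apply, Algebra.commutes] }
  refine ⟨t * t' * s, fun h => ?_,
    (c t').comp (a₁.comp (f.comp b₁)) + (c t).comp (a₂.comp (f'.comp b₂)),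
    (((hf.precomp _).postcomp _).postcomp _).add (((hf'.precomp _).postcomp _).postcomp _),
    fun m => ?_⟩
  · rcases hp.mem_or_mem h with h | h
    · exact (hp.mem_or_mem h).elim ht ht'
    · exact hs h
  · have e₁ : a₁ (f (b₁ m)) = algebraMap R Λ t • a₁ (b₁ m) := by rw [hft, map_smul]
    have e₂ : a₂ (f' (b₂ m)) = algebraMap R Λ t' • a₂ (b₂ m) := by rw [hft', map_smul]
    rw [map_mul, mul_smul, h, map_mul, mul_smul]
    simp only [LinearMap.add_apply, LinearMap.comp_apply, c, LinearMap.coe_mk, AddHom.coe_mk,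
      e₁, e₂, smul_add]
    rw [comm t' t (a₁ _)]

end ProjectiveFactorization

section PuncturedSpectrum

variable {R : Type u} [CommRing R] [IsLocalRing R] {Λ : Type u} [Ring Λ] [Algebra R Λ]
variable {ω : Type u} [AddCommGroup ω] [Module R ω]
variable {M X Y : Type u}
  [AddCommGroup M] [Module Λ M] [Module R M] [IsScalarTower R Λ M]
  [AddCommGroup X] [Module Λ X] [Module R X] [IsScalarTower R Λ X]
  [AddCommGroup Y] [Module Λ Y] [Module R Y] [IsScalarTower R Λ Y]

/-- `M` and its dual `Hom_R(M, ω)` are projective on the punctured spectrum of `R`. -/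
def PuncturedProjective (R : Type u) [CommRing R] [IsLocalRing R]
    (Λ : Type u) [Ring Λ] [Algebra R Λ] (ω : Type u) [AddCommGroup ω] [Module R ω]
    (M : Type u) [AddCommGroup M] [Module Λ M] [Module R M] [IsScalarTower R Λ M] : Prop :=
  (∀ p : Ideal R, p.IsPrime → p ≠ maximalIdeal R → LocallyProjectiveAt R Λ p M) ∧
    (∀ p : Ideal R, p.IsPrime → p ≠ maximalIdeal R →
      LocallyProjectiveAt R Λᵐᵒᵖ p (M →ₗ[R] ω))

/-- The map `Hom_R(N, ω) → Hom_R(M, ω)` induced by a `Λ`-linear map `M → N`. -/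
def omegaDualMap (ω : Type u) [AddCommGroup ω] [Module R ω] (f : M →ₗ[Λ] X) :
    (X →ₗ[R] ω) →ₗ[Λᵐᵒᵖ] (M →ₗ[R] ω) where
  toFun g := g.comp (f.restrictScalars R)
  map_add' _ _ := rfl
  map_smul' a g := LinearMap.ext fun m => by
    exact congrArg g (f.map_smul a.unop m).symm

lemma PuncturedProjective.of_maps
    (h : ∀ p : Ideal R, p.IsPrime → p ≠ maximalIdeal R → ∃ s ∉ p,
      ∃ (b₁ : M →ₗ[Λ] X) (a₁ : X →ₗ[Λ] M) (b₂ : M →ₗ[Λ] Y) (a₂ : Y →ₗ[Λ] M),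
      ∀ m, s • m = a₁ (b₁ m) + a₂ (b₂ m))
    (hX : PuncturedProjective R Λ ω X) (hY : PuncturedProjective R Λ ω Y) :
    PuncturedProjective R Λ ω M := by
  refine ⟨fun p hp hpm => ?_, fun p hp hpm => ?_⟩
  · obtain ⟨s, hs, b₁, a₁, b₂, a₂, e⟩ := h p hp hpm
    exact locallyProjectiveAt_of_maps hp hs b₁ a₁ b₂ a₂
      (fun m => by rw [← e, algebraMap_smul]) (hX.1 p hp hpm) (hY.1 p hp hpm)
  · obtain ⟨s, hs, b₁, a₁, b₂, a₂, e⟩ := h p hp hpm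
    refine locallyProjectiveAt_of_maps hp hs (omegaDualMap ω a₁) (omegaDualMap ω b₁)
      (omegaDualMap ω a₂) (omegaDualMap ω b₂) (fun g => LinearMap.ext fun m => ?_)
      (hX.2 p hp hpm) (hY.2 p hp hpm)
    change g (algebraMap R Λ s • m) = g (a₁ (b₁ m)) + g (a₂ (b₂ m))
    rw [algebraMap_smul, e, map_add]

lemma PuncturedProjective.of_retract (b : M →ₗ[Λ] X) (a : X →ₗ[Λ] M) (h : ∀ m, a (b m) = m)
    (hX : PuncturedProjective R Λ ω X) : PuncturedProjective R Λ ω M :=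
  .of_maps (fun p hp _ => ⟨1, fun h => hp.ne_top ((Ideal.eq_top_iff_one p).2 h), b, a, 0, 0,
    fun m => by simp [h]⟩) hX hX

lemma PuncturedProjective.exists_factor (hM : PuncturedProjective R Λ ω M) {p : Ideal R}
    (hp : p.IsPrime) (hpm : p ≠ maximalIdeal R) :
    ∃ s ∉ p, FactorsThroughProjective Λ (s • (LinearMap.id : M →ₗ[Λ] M)) := by
  obtain ⟨s, hs, f, hf, hfs⟩ := locallyProjectiveAt_iff.1 (hM.1 p hp hpm)
  refine ⟨s, hs, ?_⟩
  convert hf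
  ext m
  simp [hfs]

/-- Middle term of an extension. -/
lemma PuncturedProjective.of_extension (i : X →ₗ[Λ] M) (q : M →ₗ[Λ] Y)
    (hi : Function.Injective i) (hq : Function.Surjective q) (hiq : Function.Exact i q)
    (hX : PuncturedProjective R Λ ω X) (hY : PuncturedProjective R Λ ω Y) :
    PuncturedProjective R Λ ω M := by
  refine .of_maps (fun p hp hpm => ?_) hX hY
  obtain ⟨s, hs, hf⟩ := hY.exists_factor hp hpm
  obtain ⟨g, -, hg⟩ := hf.lift q hq
  have hg' (y : Y) : q (g y) = s • y := LinearMap.congr_fun hg y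
  let k : M →ₗ[Λ] M := s • LinearMap.id - g.comp q
  have hk (m : M) : k m ∈ LinearMap.range i := by
    rw [LinearMap.mem_range]
    refine (hiq (k m)).1 ?_
    simp [k, hg', LinearMap.map_smul_of_tower]
  refine ⟨s, hs, (LinearEquiv.ofInjective i hi).symm.toLinearMap.comp (k.codRestrict _ hk), i,
    q, g, fun m => ?_⟩
  have : i ((LinearEquiv.ofInjective i hi).symm (k.codRestrict _ hk m)) = k m := by simp
  simp [this, k]

/-- Kernel of a surjection. -/
lemma PuncturedProjective.of_kernel (i : X →ₗ[Λ] M) (q : M →ₗ[Λ] Y)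
    (hi : Function.Injective i) (hq : Function.Surjective q) (hiq : Function.Exact i q)
    (hM : PuncturedProjective R Λ ω M) (hY : PuncturedProjective R Λ ω Y) :
    PuncturedProjective R Λ ω X := by
  refine .of_maps (fun p hp hpm => ?_) hM hM
  obtain ⟨s, hs, hf⟩ := hY.exists_factor hp hpm
  obtain ⟨g, -, hg⟩ := hf.lift q hq
  have hg' (y : Y) : q (g y) = s • y := LinearMap.congr_fun hg y
  let k : M →ₗ[Λ] M := s • LinearMap.id - g.comp q
  have hk (m : M) : k m ∈ LinearMap.range i := by
    rw [LinearMap.mem_range]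
    refine (hiq (k m)).1 ?_
    simp [k, hg', LinearMap.map_smul_of_tower]
  refine ⟨s, hs, i, (LinearEquiv.ofInjective i hi).symm.toLinearMap.comp (k.codRestrict _ hk),
    0, 0, fun m => hi ?_⟩
  have (m : M) : i ((LinearEquiv.ofInjective i hi).symm (k.codRestrict _ hk m)) = k m := by simp
  simp [this, k, hiq.apply_apply_eq_zero, LinearMap.map_smul_of_tower]

lemma PuncturedProjective.pi (n : ℕ) (h : PuncturedProjective R Λ ω Λ) :
    PuncturedProjective R Λ ω (Fin n → Λ) := by
  induction n with
  | zero => exact .of_retract (0 : _ →ₗ[Λ] Λ) 0 (fun m => Subsingleton.elim _ _) h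
  | succ n ih =>
    refine .of_extension (X := Λ) (Y := Fin n → Λ) (LinearMap.single Λ (fun _ => Λ) 0)
      (LinearMap.funLeft Λ Λ Fin.succ) ?_ ?_ ?_ h ih
    · exact Pi.single_injective (M := fun _ : Fin (n + 1) => Λ) 0
    · exact LinearMap.funLeft_surjective_of_injective _ _ _ (Fin.succ_injective n)
    · intro f
      constructor
      · intro hf
        refine ⟨f 0, funext fun j => ?_⟩
        refine Fin.cases ?_ (fun j => ?_) j
        · simp
        · simpa using (congrFun hf j).symm
      · rintro ⟨x, rfl⟩
        ext j
        simp [LinearMap.funLeft_apply]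

end PuncturedSpectrum

section Depth

open CategoryTheory RingTheory.Sequence

variable {R : Type u} [CommRing R] [IsLocalRing R]
variable {A B C : Type u} [AddCommGroup A] [Module R A] [AddCommGroup B] [Module R B]
  [AddCommGroup C] [Module R C]

/-- Vanishing of `Ext^i(k, N)` for `i < n`, which for finitely generated nonzero modules over
noetherian local rings means that the depth of `N` is at least `n`. -/
def DepthGE (R : Type u) [CommRing R] [IsLocalRing R] (n : ℕ)
    (N : Type u) [AddCommGroup N] [Module R N] : Prop :=
  ∀ i < n, Subsingleton
    (Abelian.Ext (ModuleCat.of R (R ⧸ maximalIdeal R)) (ModuleCat.of R N) i)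

lemma DepthGE.mono {m n : ℕ} (h : DepthGE R n A) (hmn : m ≤ n) : DepthGE R m A :=
  fun i hi => h i (hi.trans_le hmn)

lemma shortExact_of {f : A →ₗ[R] B} {g : B →ₗ[R] C} (hf : Function.Injective f)
    (hg : Function.Surjective g) (hfg : Function.Exact f g) :
    (ShortComplex.mk (ModuleCat.ofHom f) (ModuleCat.ofHom g)
      (by ext x; exact hfg.apply_apply_eq_zero x)).ShortExact where
  exact := (ShortComplex.ShortExact.moduleCat_exact_iff_function_exact _).2 hfg
  mono_f := (ModuleCat.mono_iff_injective _).2 hf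
  epi_g := (ModuleCat.epi_iff_surjective _).2 hg

lemma DepthGE.of_extension {n : ℕ} (f : A →ₗ[R] B) (g : B →ₗ[R] C) (hf : Function.Injective f)
    (hg : Function.Surjective g) (hfg : Function.Exact f g)
    (hA : DepthGE R n A) (hC : DepthGE R n C) : DepthGE R n B := by
  intro i hi
  have := hA i hi
  have := hC i hi
  refine subsingleton_of_forall_eq 0 fun x => ?_
  obtain ⟨y, rfl⟩ := Abelian.Ext.covariant_sequence_exact₂ _ (shortExact_of hf hg hfg) x
    (Subsingleton.elim _ _)
  rw [Subsingleton.elim y 0]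
  simp

lemma DepthGE.of_kernel {n : ℕ} (f : A →ₗ[R] B) (g : B →ₗ[R] C) (hf : Function.Injective f)
    (hg : Function.Surjective g) (hfg : Function.Exact f g)
    (hB : DepthGE R n B) (hC : DepthGE R n C) : DepthGE R n A := by
  intro i hi
  have hBi := hB i hi
  refine subsingleton_of_forall_eq 0 fun x => ?_
  have S := shortExact_of hf hg hfg
  match i with
  | 0 =>
    have : Mono (ModuleCat.ofHom f) := S.mono_f
    exact Abelian.Ext.postcomp_mk₀_injective_of_mono (ModuleCat.of R (R ⧸ maximalIdeal R))
      (ModuleCat.ofHom f) (@Subsingleton.elim _ hBi _ _)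
  | i + 1 =>
    have := hC i (by omega)
    obtain ⟨y, rfl⟩ := Abelian.Ext.covariant_sequence_exact₁ _ S x (Subsingleton.elim _ _) rfl
    rw [Subsingleton.elim y 0]
    simp

lemma DepthGE.of_cokernel {n : ℕ} (f : A →ₗ[R] B) (g : B →ₗ[R] C) (hf : Function.Injective f)
    (hg : Function.Surjective g) (hfg : Function.Exact f g)
    (hA : DepthGE R (n + 1) A) (hB : DepthGE R n B) : DepthGE R n C := by
  intro i hi
  have := hB i hi
  have := hA (i + 1) (by omega)
  refine subsingleton_of_forall_eq 0 fun x => ?_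
  obtain ⟨y, rfl⟩ := Abelian.Ext.covariant_sequence_exact₃ _ (shortExact_of hf hg hfg) x rfl
    (Subsingleton.elim _ _)
  rw [Subsingleton.elim y 0]
  simp

lemma DepthGE.of_retract {n : ℕ} (f : A →ₗ[R] B) (g : B →ₗ[R] A) (h : ∀ a, g (f a) = a)
    (hB : DepthGE R n B) : DepthGE R n A := by
  intro i hi
  have := hB i hi
  refine subsingleton_of_forall_eq 0 fun x => ?_
  have e : ModuleCat.ofHom f ≫ ModuleCat.ofHom g = 𝟙 (ModuleCat.of R A) := by
    ext a
    exact h a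
  rw [← x.comp_mk₀_id, ← e, ← Abelian.Ext.mk₀_comp_mk₀,
    ← Abelian.Ext.comp_assoc_of_second_deg_zero,
    Subsingleton.elim (x.comp (Abelian.Ext.mk₀ (ModuleCat.ofHom f)) (add_zero i)) 0]
  simp

variable [IsNoetherianRing R]

lemma maximalIdeal_smul_top_lt [Module.Finite R A] [Nontrivial A] :
    maximalIdeal R • (⊤ : Submodule R A) < ⊤ := by
  refine lt_top_iff_ne_top.2 fun h => ?_
  have := Submodule.eq_bot_of_le_smul_of_le_jacobson_bot (maximalIdeal R) (⊤ : Submodule R A)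
    Module.Finite.fg_top h.ge (maximalIdeal_le_jacobson _)
  exact top_ne_bot this

lemma depthGE_iff [Module.Finite R A] [Nontrivial A] {n : ℕ} :
    DepthGE R n A ↔ ∃ rs : List R, rs.length = n ∧ (∀ r ∈ rs, r ∈ maximalIdeal R) ∧
      IsRegular A rs := by
  have supp : Module.support R (ModuleCat.of R (R ⧸ maximalIdeal R)) =
      PrimeSpectrum.zeroLocus (maximalIdeal R) := by
    change Module.support R (R ⧸ maximalIdeal R) = _
    rw [Module.support_eq_zeroLocus, Ideal.annihilator_quotient]
  constructor
  · intro h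
    exact ModuleCat.exists_isRegular_of_exists_subsingleton_ext (maximalIdeal R) n
      (ModuleCat.of R A) maximalIdeal_smul_top_lt
      (ModuleCat.of R (R ⧸ maximalIdeal R)) supp h
  · rintro ⟨rs, rfl, mem, reg⟩
    exact ModuleCat.subsingleton_ext_of_exists_isRegular (maximalIdeal R)
      (ModuleCat.of R (R ⧸ maximalIdeal R)) supp.subset (ModuleCat.of R A)
      maximalIdeal_smul_top_lt rs mem reg

lemma isMCM_iff [Module.Finite R A] {d : ℕ} (hd : ringKrullDim R = d) :
    IsMCM R A ↔ Nontrivial A ∧ DepthGE R d A := by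
  constructor
  · rintro ⟨rs, mem, reg, hrs⟩
    have : Nontrivial A := reg.nontrivial
    refine ⟨this, depthGE_iff.2 ⟨rs, ?_, mem, reg⟩⟩
    rw [hd] at hrs
    exact_mod_cast hrs
  · rintro ⟨_, h⟩
    obtain ⟨rs, len, mem, reg⟩ := depthGE_iff.1 h
    exact ⟨rs, mem, reg, by rw [hd, len]⟩

lemma DepthGE.exists_isSMulRegular [Module.Finite R A] (h : DepthGE R 1 A) :
    ∃ y ∈ maximalIdeal R, IsSMulRegular A y := by
  cases subsingleton_or_nontrivial A
  · exact ⟨0, zero_mem _, fun _ _ _ => Subsingleton.elim _ _⟩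
  · obtain ⟨rs, len, mem, reg⟩ := depthGE_iff.1 h
    match rs with
    | y :: rs => exact ⟨y, mem y (by simp), ((isRegular_cons_iff _ _ _).1 reg).1⟩

end Depth

section LatticeClosure

variable {R : Type u} [CommRing R] [IsLocalRing R] [IsNoetherianRing R]
  {Λ : Type u} [Ring Λ] [Algebra R Λ] [Module.Finite R Λ]
variable {ω : Type u} [AddCommGroup ω] [Module R ω]
variable {M X Y : Type u}
  [AddCommGroup M] [Module Λ M] [Module R M] [IsScalarTower R Λ M]
  [AddCommGroup X] [Module Λ X] [Module R X] [IsScalarTower R Λ X]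
  [AddCommGroup Y] [Module Λ Y] [Module R Y] [IsScalarTower R Λ Y]

lemma isLattice_iff {d : ℕ} (hd : ringKrullDim R = d) :
    IsLattice R Λ ω M ↔ Module.Finite Λ M ∧ Nontrivial M ∧ DepthGE R d M ∧
      PuncturedProjective R Λ ω M := by
  constructor
  · rintro ⟨hM, h, h'⟩
    have := Module.Finite.trans (R := R) Λ M
    exact ⟨hM, ((isMCM_iff hd).1 h).1, ((isMCM_iff hd).1 h).2, h'⟩
  · rintro ⟨hM, h, h', h''⟩
    have := Module.Finite.trans (R := R) Λ M
    exact ⟨hM, (isMCM_iff hd).2 ⟨h, h'⟩, h''⟩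

lemma IsLattice.of_retract {d : ℕ} (hd : ringKrullDim R = d) [Nontrivial M] (b : M →ₗ[Λ] X)
    (a : X →ₗ[Λ] M) (h : ∀ m, a (b m) = m) (hX : IsLattice R Λ ω X) : IsLattice R Λ ω M := by
  rw [isLattice_iff hd] at *
  obtain ⟨_, h₂, h₃, h₄⟩ := hX
  exact ⟨Module.Finite.of_surjective a fun m => ⟨b m, h m⟩, inferInstance,
    h₃.of_retract (b.restrictScalars R) (a.restrictScalars R) h, h₄.of_retract b a h⟩

lemma IsLattice.of_extension {d : ℕ} (hd : ringKrullDim R = d) (i : X →ₗ[Λ] M) (q : M →ₗ[Λ] Y)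
    (hi : Function.Injective i) (hq : Function.Surjective q) (hiq : Function.Exact i q)
    (hX : IsLattice R Λ ω X) (hY : IsLattice R Λ ω Y) : IsLattice R Λ ω M := by
  rw [isLattice_iff hd] at *
  obtain ⟨_, h₂, h₃, h₄⟩ := hX
  obtain ⟨_, h₂', h₃', h₄'⟩ := hY
  refine ⟨⟨Submodule.fg_of_fg_map_of_fg_inf_ker q ?_ ?_⟩, hi.nontrivial,
    .of_extension (i.restrictScalars R) (q.restrictScalars R) hi hq hiq h₃ h₃',
    .of_extension i q hi hq hiq h₄ h₄'⟩
  · rw [Submodule.map_top, LinearMap.range_eq_top.2 hq]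
    exact Module.Finite.fg_top
  · rw [top_inf_eq, LinearMap.exact_iff.1 hiq, ← Submodule.map_top]
    exact Module.Finite.fg_top.map _

lemma IsLattice.of_kernel {d : ℕ} (hd : ringKrullDim R = d) [Nontrivial X] (i : X →ₗ[Λ] M)
    (q : M →ₗ[Λ] Y)
    (hi : Function.Injective i) (hq : Function.Surjective q) (hiq : Function.Exact i q)
    (hM : IsLattice R Λ ω M) (hY : IsLattice R Λ ω Y) : IsLattice R Λ ω X := by
  rw [isLattice_iff hd] at *
  obtain ⟨_, h₂, h₃, h₄⟩ := hM
  obtain ⟨_, h₂', h₃', h₄'⟩ := hY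
  have := Module.Finite.trans (R := R) Λ M
  refine ⟨?_, inferInstance,
    .of_kernel (i.restrictScalars R) (q.restrictScalars R) hi hq hiq h₃ h₃',
    .of_kernel i q hi hq hiq h₄ h₄'⟩
  have : Module.Finite R X := Module.Finite.of_injective (i.restrictScalars R) hi
  exact Module.Finite.of_restrictScalars_finite R Λ X

lemma DepthGE.pi {d : ℕ} (h : DepthGE R d Λ) (n : ℕ) : DepthGE R d (Fin n → Λ) := by
  induction n with
  | zero =>
    exact .of_retract (0 : _ →ₗ[R] Λ) 0 (fun m => Subsingleton.elim _ _) h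
  | succ n ih =>
    refine .of_extension (A := Λ) (C := Fin n → Λ) (LinearMap.single R (fun _ => Λ) 0)
      (LinearMap.funLeft R Λ Fin.succ) ?_ ?_ ?_ h ih
    · exact Pi.single_injective (M := fun _ : Fin (n + 1) => Λ) 0
    · exact LinearMap.funLeft_surjective_of_injective _ _ _ (Fin.succ_injective n)
    · intro f
      constructor
      · intro hf
        refine ⟨f 0, funext fun j => ?_⟩
        refine Fin.cases ?_ (fun j => ?_) j
        · simp
        · simpa using (congrFun hf j).symm
      · rintro ⟨x, rfl⟩
        ext j
        simp [LinearMap.funLeft_apply]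

lemma IsLattice.pi {d : ℕ} (hd : ringKrullDim R = d) (h : IsLattice R Λ ω Λ) {n : ℕ}
    (hn : n ≠ 0) : IsLattice R Λ ω (Fin n → Λ) := by
  rw [isLattice_iff hd] at *
  obtain ⟨_, h₂, h₃, h₄⟩ := h
  have : Nonempty (Fin n) := ⟨⟨0, Nat.pos_of_ne_zero hn⟩⟩
  exact ⟨inferInstance, inferInstance, h₃.pi n, .pi n h₄⟩

lemma IsLattice.prod {d : ℕ} (hd : ringKrullDim R = d) (hX : IsLattice R Λ ω X)
    (hY : IsLattice R Λ ω Y) : IsLattice R Λ ω (X × Y) :=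
  .of_extension hd (LinearMap.inl Λ X Y) (LinearMap.snd Λ X Y) LinearMap.inl_injective
    LinearMap.snd_surjective Function.Exact.inl_snd hX hY

end LatticeClosure

section LocalEndomorphisms

open TensorProduct Polynomial

lemma isAdicComplete_of_finite {R : Type u} [CommRing R] [IsNoetherianRing R] (I : Ideal R)
    [IsAdicComplete I R] (M : Type u) [AddCommGroup M] [Module R M] [Module.Finite R M] :
    IsAdicComplete I M := by
  rw [← AdicCompletion.of_bijective_iff]
  have e : ⇑(AdicCompletion.of I M) = ⇑(AdicCompletion.ofTensorProduct I M) ∘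
      ⇑((TensorProduct.lid R M).symm.trans
        (TensorProduct.congr (AdicCompletion.ofLinearEquiv I R) (.refl R M))) := by
    ext1 m
    simp only [Function.comp_apply, LinearEquiv.trans_apply, TensorProduct.lid_symm_apply,
      TensorProduct.congr_tmul, AdicCompletion.ofLinearEquiv_apply, LinearEquiv.refl_apply,
      AdicCompletion.ofTensorProduct_tmul]
    exact (one_smul (AdicCompletion I R) _).symm
  rw [e]
  exact (AdicCompletion.ofTensorProduct_bijective_of_finite_of_isNoetherian I M).comp
    (LinearEquiv.bijective _)

variable {R : Type u} [CommRing R] [IsLocalRing R] [IsNoetherianRing R]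
  [IsAdicComplete (maximalIdeal R) R]

lemma isUnit_or_isUnit_one_sub_of_idempotents {C : Type u} [CommRing C] [Algebra R C]
    [Module.Finite R C] (h : ∀ e : C, IsIdempotentElem e → e = 0 ∨ e = 1) (x : C) :
    IsUnit x ∨ IsUnit (1 - x) := by
  set J := (maximalIdeal R).map (algebraMap R C) with hJ
  have : IsAdicComplete (maximalIdeal R) C := isAdicComplete_of_finite _ C
  have : IsAdicComplete J C := (IsAdicComplete.map_algebraMap_iff (maximalIdeal R) C).2 this
  have hH : HenselianRing C J := inferInstance
  have : Module.Finite (R ⧸ maximalIdeal R) (C ⧸ J) :=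
    Module.Finite.of_restrictScalars_finite R _ _
  have hA : IsArtinianRing (C ⧸ J) := by
    have : IsArtinianRing (R ⧸ maximalIdeal R) := by
      let _ := Ideal.Quotient.field (maximalIdeal R)
      infer_instance
    exact IsArtinianRing.of_finite (R ⧸ maximalIdeal R) (C ⧸ J)
  have unit_of (z : C) (hz : IsUnit (Ideal.Quotient.mk J z)) : IsUnit z := by
    obtain ⟨w, hw⟩ := hz.exists_right_inv
    obtain ⟨w, rfl⟩ := Ideal.Quotient.mk_surjective w
    have : z * w - 1 ∈ J := by
      rw [← Ideal.Quotient.eq, map_mul, hw, map_one]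
    have := Ideal.mem_jacobson_bot.1 (hH.jac this) 1
    exact isUnit_of_mul_isUnit_left (by simpa using this)
  obtain ⟨n, y, hy⟩ := IsArtinian.exists_pow_succ_smul_dvd (Ideal.Quotient.mk J x) (1 : C ⧸ J)
  obtain ⟨y, rfl⟩ := Ideal.Quotient.mk_surjective y
  set xJ := Ideal.Quotient.mk J x
  set yJ := Ideal.Quotient.mk J y
  replace hy : xJ ^ (n + 1) * yJ = xJ ^ n := by simpa using hy
  have key (k : ℕ) : xJ ^ (n + 1 + k) * yJ ^ k = xJ ^ (n + 1) := by
    induction k with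
    | zero => simp
    | succ k ih =>
      calc xJ ^ (n + 1 + (k + 1)) * yJ ^ (k + 1) = xJ ^ (k + 1) * (xJ ^ (n + 1) * yJ) * yJ ^ k := by ring
        _ = xJ ^ (n + 1 + k) * yJ ^ k := by rw [hy]; ring
        _ = _ := ih
  set e := x ^ (n + 1) * y ^ (n + 1)
  have he : Ideal.Quotient.mk J e * Ideal.Quotient.mk J e = Ideal.Quotient.mk J e := by
    simp only [e, map_mul, map_pow]
    calc xJ ^ (n + 1) * yJ ^ (n + 1) * (xJ ^ (n + 1) * yJ ^ (n + 1))
        = xJ ^ (n + 1 + (n + 1)) * yJ ^ (n + 1) * yJ ^ (n + 1) := by ring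
      _ = _ := by rw [key]
  obtain ⟨e', he', hee'⟩ := hH.is_henselian (X * X - X)
    (by rw [← pow_two]; monicity!)
    e (by
      rw [← Ideal.Quotient.eq_zero_iff_mem]
      simp [he])
    (by
      have h2 : eval e (derivative (X * X - X)) = 2 * e - 1 := by
        simp
        ring
      refine IsUnit.of_mul_eq_one (Ideal.Quotient.mk J (2 * e - 1)) ?_
      rw [h2, map_sub, map_mul, map_one, map_ofNat]
      linear_combination 4 * he)
  rw [IsRoot, eval_sub, eval_mul, eval_X, sub_eq_zero] at he'
  have hmk : Ideal.Quotient.mk J e' = xJ ^ (n + 1) * yJ ^ (n + 1) := by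
    rw [Ideal.Quotient.eq.2 hee']
    simp [e, xJ, yJ]
  rcases h e' he' with rfl | rfl
  · right
    rw [map_zero] at hmk
    have hX : xJ ^ (n + 1) = 0 := by
      calc xJ ^ (n + 1) = xJ ^ (n + 1 + (n + 1)) * yJ ^ (n + 1) := (key (n + 1)).symm
        _ = xJ ^ (n + 1) * (xJ ^ (n + 1) * yJ ^ (n + 1)) := by ring
        _ = 0 := by rw [← hmk, mul_zero]
    refine unit_of _ ?_
    rw [map_sub, map_one]
    exact IsNilpotent.isUnit_one_sub ⟨_, hX⟩
  · left
    rw [map_one] at hmk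
    refine unit_of _ (IsUnit.of_mul_eq_one (xJ ^ n * yJ ^ (n + 1)) ?_)
    rw [hmk]
    ring

variable {Λ : Type u} [Ring Λ] [Algebra R Λ] {M : Type u}
  [AddCommGroup M] [Module Λ M] [Module R M] [IsScalarTower R Λ M]

lemma eq_zero_or_eq_one_of_isIdempotentElem (hM : IsIndecomposable Λ M) {e : Module.End Λ M}
    (he : IsIdempotentElem e) : e = 0 ∨ e = 1 := by
  rcases hM.2 _ _ (LinearMap.IsIdempotentElem.isCompl he) with h | h
  · exact .inl (LinearMap.range_eq_bot.1 h)
  · refine .inr (LinearMap.ext fun m => LinearMap.ker_eq_bot.1 h ?_)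
    exact LinearMap.congr_fun he m

/-- Endomorphisms of indecomposable modules over a complete local ring. -/
lemma bijective_or_bijective_one_sub [Module.Finite R M] (hM : IsIndecomposable Λ M)
    (f : M →ₗ[Λ] M) :
    Function.Bijective f ∨ Function.Bijective (LinearMap.id - f : M →ₗ[Λ] M) := by
  let φ : R[X] →ₐ[R] Module.End Λ M := aeval f
  have inj := Ideal.kerLiftAlg_injective φ
  have : Module.Finite R (Module.End Λ M) := by
    let j : Module.End Λ M →ₗ[R] Module.End R M :=
      { toFun := fun g => g.restrictScalars R
        map_add' := fun _ _ => rfl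
        map_smul' := fun _ _ => rfl }
    exact Module.Finite.of_injective j fun a b h => LinearMap.ext fun m => LinearMap.congr_fun h m
  have : Module.Finite R (R[X] ⧸ RingHom.ker φ) :=
    Module.Finite.of_injective (Ideal.kerLiftAlg φ).toLinearMap inj
  have hx : Ideal.kerLiftAlg φ (Ideal.Quotient.mk _ X) = f := by
    change φ X = f
    simp [φ]
  have bij (z : R[X] ⧸ RingHom.ker φ) (hz : IsUnit z) :
      Function.Bijective (Ideal.kerLiftAlg φ z) :=
    (Module.End.isUnit_iff _).1 (hz.map (Ideal.kerLiftAlg φ))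
  refine (isUnit_or_isUnit_one_sub_of_idempotents (R := R) (fun e he => ?_)
    (Ideal.Quotient.mk (RingHom.ker φ) X)).imp (fun h => ?_) (fun h => ?_)
  · rcases eq_zero_or_eq_one_of_isIdempotentElem hM
      (e := Ideal.kerLiftAlg φ e) (he.map (Ideal.kerLiftAlg φ)) with h | h
    · exact .inl (inj (by rw [h, map_zero]))
    · exact .inr (inj (by rw [h, map_one]))
  · simpa [hx] using bij _ h
  · have := bij _ h
    rw [map_sub, map_one, hx] at this
    exact this

end LocalEndomorphisms

section Reduction

variable {R : Type u} [CommRing R] [IsLocalRing R] {Λ : Type u} [Ring Λ] [Algebra R Λ]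
variable {M N : Type u}
  [AddCommGroup M] [Module Λ M] [Module R M] [IsScalarTower R Λ M]
  [AddCommGroup N] [Module Λ N] [Module R N] [IsScalarTower R Λ N]

/-- The submodule of `N` generated by the multiples of the squares of the entries of `xs`. -/
def redSub (Λ : Type u) [Ring Λ] [Algebra R Λ] :
    List R → ∀ (N : Type u) [AddCommGroup N] [Module Λ N] [Module R N] [IsScalarTower R Λ N],
      Submodule Λ N
  | [], _, _, _, _, _ => ⊥
  | x :: xs, N, _, _, _, _ => redSub Λ xs N ⊔ LinearMap.range (x ^ 2 • (LinearMap.id : N →ₗ[Λ] N))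

/-- The entries of `xs` (read from the end) form a weakly regular sequence on `N`, with respect
to the submodules `redSub`. -/
def WReg (Λ : Type u) [Ring Λ] [Algebra R Λ] :
    List R → ∀ (N : Type u) [AddCommGroup N] [Module Λ N] [Module R N] [IsScalarTower R Λ N], Prop
  | [], _, _, _, _, _ => True
  | x :: xs, N, _, _, _, _ => WReg Λ xs N ∧ ∀ n : N, x • n ∈ redSub Λ xs N → n ∈ redSub Λ xs N

lemma mem_redSub_cons {x : R} {xs : List R} {n : N} :
    n ∈ redSub Λ (x :: xs) N ↔ ∃ s ∈ redSub Λ xs N, ∃ m, s + x ^ 2 • m = n := by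
  simp [redSub, Submodule.mem_sup]

lemma redSub_map (f : M →ₗ[Λ] N) {xs : List R} {m : M} (hm : m ∈ redSub Λ xs M) :
    f m ∈ redSub Λ xs N := by
  induction xs generalizing m with
  | nil =>
    have : m = 0 := hm
    rw [this, map_zero]
    exact zero_mem _
  | cons x xs ih =>
    obtain ⟨s, hs, m', rfl⟩ := mem_redSub_cons.1 hm
    exact mem_redSub_cons.2 ⟨f s, ih hs, f m', by rw [map_add, LinearMap.map_smul_of_tower]⟩

lemma redSub_le {xs : List R} (hxs : ∀ x ∈ xs, x ∈ maximalIdeal R) {n : N}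
    (hn : n ∈ redSub Λ xs N) : n ∈ maximalIdeal R • (⊤ : Submodule R N) := by
  induction xs generalizing n with
  | nil =>
    have : n = 0 := hn
    rw [this]
    exact zero_mem _
  | cons x xs ih =>
    obtain ⟨s, hs, m', rfl⟩ := mem_redSub_cons.1 hn
    exact add_mem (ih (fun x hx => hxs x (by simp [hx])) hs) (Submodule.smul_mem_smul
      (Ideal.pow_mem_of_mem _ (hxs x (by simp)) 2 two_pos) trivial)

/-- Reduction of a map modulo the submodules `redSub`. -/
def redMap (xs : List R) (f : M →ₗ[Λ] N) : (M ⧸ redSub Λ xs M) →ₗ[Λ] (N ⧸ redSub Λ xs N) :=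
  Submodule.mapQ _ _ f fun _ hm => redSub_map f hm

lemma redMap_mk (xs : List R) (f : M →ₗ[Λ] N) (m : M) :
    redMap xs f (Submodule.Quotient.mk m) = Submodule.Quotient.mk (f m) := rfl

/-- Division by an element acting injectively. -/
lemma exists_smul_eq {x : R} (hx : ∀ n : N, x • n = 0 → n = 0) (f : M →ₗ[Λ] N)
    (hf : ∀ m, ∃ n, x • n = f m) : ∃ g : M →ₗ[Λ] N, x • g = f := by
  let μ : N →ₗ[Λ] N := x • LinearMap.id
  have hμ : Function.Injective μ := (injective_iff_map_eq_zero μ).2 fun n hn => hx n hn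
  refine ⟨(LinearEquiv.ofInjective μ hμ).symm.toLinearMap.comp (f.codRestrict _ hf),
    LinearMap.ext fun m => ?_⟩
  have : μ ((LinearEquiv.ofInjective μ hμ).symm (f.codRestrict _ hf m)) = f m := by
    simp [LinearMap.codRestrict]
  exact this

lemma exists_lift_step {x : R}
    (hM : FactorsThroughProjective Λ (x • (LinearMap.id : M →ₗ[Λ] M))) {S S' : Submodule Λ N}
    (hS' : S' = S ⊔ LinearMap.range (x ^ 2 • (LinearMap.id : N →ₗ[Λ] N)))
    (hS : ∀ n : N, x • n ∈ S → n ∈ S) (φ : M →ₗ[Λ] N ⧸ S') :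
    ∃ ψ : M →ₗ[Λ] N ⧸ S, ∀ m n, φ m = S'.mkQ n → ∃ n', ψ m = S.mkQ (n + x • n') := by
  obtain ⟨Q, _, _, _, a, p, hap⟩ := hM
  obtain ⟨ψ, hψ⟩ := Module.projective_lifting_property S'.mkQ (φ.comp p) S'.mkQ_surjective
  have key (m : M) (n : N) (h : φ m = S'.mkQ n) :
      ∃ n', S.mkQ (ψ (a m)) = x • S.mkQ (n + x • n') := by
    have h1 : S'.mkQ (ψ (a m)) = S'.mkQ (x • n) := by
      have h2 := LinearMap.congr_fun hψ (a m)
      have h3 := LinearMap.congr_fun hap m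
      simp only [LinearMap.comp_apply, LinearMap.smul_apply, LinearMap.id_apply] at h2 h3
      rw [h2, h3, LinearMap.map_smul_of_tower, h, LinearMap.map_smul_of_tower]
    rw [Submodule.mkQ_apply, Submodule.mkQ_apply, Submodule.Quotient.eq, hS',
      Submodule.mem_sup] at h1
    obtain ⟨s, hs, -, ⟨n', rfl⟩, h4⟩ := h1
    refine ⟨n', ?_⟩
    rw [← LinearMap.map_smul_of_tower, Submodule.mkQ_apply, Submodule.mkQ_apply,
      Submodule.Quotient.eq]
    convert hs using 1
    rw [eq_comm, ← sub_eq_iff_eq_add] at h4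
    rw [← sub_eq_zero, ← sub_eq_zero.2 h4]
    simp only [LinearMap.smul_apply, LinearMap.id_apply, smul_add, smul_smul, pow_two]
    abel
  obtain ⟨g, hg⟩ := exists_smul_eq (x := x) (N := N ⧸ S) (fun n hn => by
      obtain ⟨n, rfl⟩ := S.mkQ_surjective n
      rw [← LinearMap.map_smul_of_tower, Submodule.mkQ_apply, Submodule.Quotient.mk_eq_zero] at hn
      rw [Submodule.mkQ_apply, Submodule.Quotient.mk_eq_zero]
      exact hS n hn) (S.mkQ.comp (ψ.comp a)) (fun m => by
      obtain ⟨n, hn⟩ := S'.mkQ_surjective (φ m)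
      obtain ⟨n', hn'⟩ := key m n hn.symm
      exact ⟨_, hn'.symm⟩)
  refine ⟨g, fun m n h => ?_⟩
  obtain ⟨n', hn'⟩ := key m n h
  refine ⟨n', ?_⟩
  have h5 := LinearMap.congr_fun hg m
  rw [LinearMap.smul_apply, LinearMap.comp_apply, LinearMap.comp_apply, hn', ← sub_eq_zero,
    ← smul_sub] at h5
  rw [← sub_eq_zero]
  obtain ⟨z, hz⟩ := S.mkQ_surjective (g m - S.mkQ (n + x • n'))
  rw [← hz] at h5 ⊢
  rw [← LinearMap.map_smul_of_tower, Submodule.mkQ_apply, Submodule.Quotient.mk_eq_zero] at h5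
  rw [Submodule.mkQ_apply, Submodule.Quotient.mk_eq_zero]
  exact hS z h5

/-- Maps into a reduction lift, up to `𝔪 N`. -/
lemma exists_lift_redSub {xs : List R} (hxs : ∀ x ∈ xs, x ∈ maximalIdeal R)
    (hM : ∀ x ∈ xs, FactorsThroughProjective Λ (x • (LinearMap.id : M →ₗ[Λ] M)))
    (hN : WReg Λ xs N) (φ : M →ₗ[Λ] N ⧸ redSub Λ xs N) :
    ∃ χ : M →ₗ[Λ] N, ∀ m n, φ m = (redSub Λ xs N).mkQ n →
      χ m - n ∈ maximalIdeal R • (⊤ : Submodule R N) := by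
  induction xs with
  | nil =>
    refine ⟨(Submodule.quotEquivOfEqBot (redSub Λ [] N) rfl).toLinearMap.comp φ,
      fun m n h => ?_⟩
    have e : (Submodule.quotEquivOfEqBot (redSub Λ ([] : List R) N) rfl)
        ((redSub Λ ([] : List R) N).mkQ n) = n := rfl
    rw [LinearMap.comp_apply, h, LinearEquiv.coe_coe, e, sub_self]
    exact zero_mem _
  | cons x xs ih =>
    obtain ⟨ψ, hψ⟩ := exists_lift_step (hM x (by simp)) rfl hN.2 φ
    obtain ⟨χ, hχ⟩ := ih (fun x hx => hxs x (by simp [hx])) (fun x hx => hM x (by simp [hx]))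
      hN.1 ψ
    refine ⟨χ, fun m n h => ?_⟩
    obtain ⟨n', hn'⟩ := hψ m n h
    have h₁ : x • n' ∈ maximalIdeal R • (⊤ : Submodule R N) :=
      Submodule.smul_mem_smul (hxs x (by simp)) trivial
    convert add_mem (hχ m _ hn') h₁ using 1
    abel

/-- A property of maps out of `M` which is additive, liftable along quotient maps and satisfied
by multiples of the entries of `xs` holds for all maps with image in `redSub`. -/
lemma of_range_le_redSub
    (P : ∀ (N : Type u) [AddCommGroup N] [Module Λ N], (M →ₗ[Λ] N) → Prop)
    (zero : ∀ (N : Type u) [AddCommGroup N] [Module Λ N], P N (0 : M →ₗ[Λ] N))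
    (add : ∀ (N : Type u) [AddCommGroup N] [Module Λ N] (f g : M →ₗ[Λ] N),
      P N f → P N g → P N (f + g))
    (lift : ∀ (N : Type u) [AddCommGroup N] [Module Λ N] (S : Submodule Λ N) (f : M →ₗ[Λ] N ⧸ S),
      P _ f → ∃ g : M →ₗ[Λ] N, P _ g ∧ S.mkQ.comp g = f) {xs : List R}
    (smul : ∀ x ∈ xs, ∀ (N : Type u) [AddCommGroup N] [Module Λ N] [Module R N]
      [IsScalarTower R Λ N] (f : M →ₗ[Λ] N), P N (x • f))
    (hN : WReg Λ xs N) (f : M →ₗ[Λ] N) (hf : ∀ m, f m ∈ redSub Λ xs N) : P N f := by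
  induction xs generalizing f with
  | nil =>
    have : f = 0 := LinearMap.ext fun m => hf m
    rw [this]
    exact zero N
  | cons x xs ih =>
    set S := redSub Λ xs N
    obtain ⟨g, hg⟩ := exists_smul_eq (x := x) (N := N ⧸ S) (fun n hn => by
      obtain ⟨n, rfl⟩ := S.mkQ_surjective n
      rw [← LinearMap.map_smul_of_tower, Submodule.mkQ_apply, Submodule.Quotient.mk_eq_zero] at hn
      rw [Submodule.mkQ_apply, Submodule.Quotient.mk_eq_zero]
      exact hN.2 n hn) (S.mkQ.comp f) (fun m => by
      obtain ⟨s, hs, n, hn⟩ := mem_redSub_cons.1 (hf m)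
      refine ⟨S.mkQ (x • n), ?_⟩
      rw [← LinearMap.map_smul_of_tower, smul_smul, ← pow_two, LinearMap.comp_apply, eq_comm,
        Submodule.mkQ_apply, Submodule.mkQ_apply, Submodule.Quotient.eq, ← hn, add_sub_cancel_right]
      exact hs)
    obtain ⟨f', hf', h⟩ := lift N S (x • g) (smul x (by simp) _ g)
    have hff' : P N (f - f') := by
      refine ih (fun x hx => smul x (by simp [hx])) hN.1 _ fun m => ?_
      have := LinearMap.congr_fun (h.trans hg) m
      rw [LinearMap.comp_apply, LinearMap.comp_apply, Submodule.mkQ_apply, Submodule.mkQ_apply,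
        eq_comm, Submodule.Quotient.eq] at this
      exact this
    simpa using add N _ _ hff' hf'

lemma FactorsThroughProjective.of_range_le_redSub {xs : List R}
    (hM : ∀ x ∈ xs, FactorsThroughProjective Λ (x • (LinearMap.id : M →ₗ[Λ] M)))
    (hN : WReg Λ xs N) (f : M →ₗ[Λ] N) (hf : ∀ m, f m ∈ redSub Λ xs N) :
    FactorsThroughProjective Λ f := by
  refine BT.of_range_le_redSub (fun N _ _ f => FactorsThroughProjective Λ f)
    (fun N _ _ => .zero) (fun N _ _ f g hf hg => hf.add hg)
    (fun N _ _ S f hf => hf.lift _ S.mkQ_surjective) (fun x hx N _ _ _ _ f => ?_) hN f hf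
  convert (hM x hx).postcomp f using 1
  ext m
  simp [LinearMap.map_smul_of_tower]

/-- Maps from a syzygy `K` of `L` with image in `redSub` extend to the projective cover. -/
lemma exists_extension_of_range_le_redSub {K P L : Type u}
    [AddCommGroup K] [Module Λ K] [Module R K] [IsScalarTower R Λ K]
    [AddCommGroup P] [Module Λ P] [Module R P] [IsScalarTower R Λ P]
    [AddCommGroup L] [Module Λ L] [Module R L] [IsScalarTower R Λ L]
    [Module.Projective Λ P] (i : K →ₗ[Λ] P) (q : P →ₗ[Λ] L)
    (hi : Function.Injective i) (hq : Function.Surjective q) (hiq : Function.Exact i q)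
    {xs : List R}
    (hL : ∀ x ∈ xs, FactorsThroughProjective Λ (x • (LinearMap.id : L →ₗ[Λ] L)))
    (hN : WReg Λ xs N) (f : K →ₗ[Λ] N) (hf : ∀ m, f m ∈ redSub Λ xs N) :
    ∃ g : P →ₗ[Λ] N, g.comp i = f := by
  refine BT.of_range_le_redSub (fun N _ _ f => ∃ g : P →ₗ[Λ] N, g.comp i = f)
    (fun N _ _ => ⟨0, by simp⟩)
    (fun N _ _ f f' ⟨g, hg⟩ ⟨g', hg'⟩ => ⟨g + g', by rw [LinearMap.add_comp, hg, hg']⟩)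
    (fun N _ _ S f ⟨g, hg⟩ => ?_) (fun x hx N _ _ _ _ f => ?_) hN f hf
  · obtain ⟨g', hg'⟩ := Module.projective_lifting_property S.mkQ g S.mkQ_surjective
    exact ⟨g'.comp i, ⟨g', rfl⟩, by rw [← LinearMap.comp_assoc, hg', hg]⟩
  · obtain ⟨s, -, hs⟩ := (hL x hx).lift q hq
    have hs' (l : L) : q (s l) = x • l := LinearMap.congr_fun hs l
    let k : P →ₗ[Λ] P := x • LinearMap.id - s.comp q
    have hk (m : P) : k m ∈ LinearMap.range i := by
      rw [LinearMap.mem_range]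
      refine (hiq (k m)).1 ?_
      simp [k, hs', LinearMap.map_smul_of_tower]
    refine ⟨f.comp ((LinearEquiv.ofInjective i hi).symm.toLinearMap.comp (k.codRestrict _ hk)),
      LinearMap.ext fun m => ?_⟩
    have : (LinearEquiv.ofInjective i hi).symm (k.codRestrict _ hk (i m)) = x • m := by
      apply hi
      have : i ((LinearEquiv.ofInjective i hi).symm (k.codRestrict _ hk (i m))) = k (i m) := by
        simp
      rw [this]
      simp [k, hiq.apply_apply_eq_zero, LinearMap.map_smul_of_tower]
    rw [LinearMap.comp_apply, LinearMap.comp_apply, LinearMap.comp_apply]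
    exact (congrArg f this).trans (by simp [LinearMap.map_smul_of_tower])

end Reduction

section RegularSequences

variable {R : Type u} [CommRing R] [IsLocalRing R] [IsNoetherianRing R]
  {Λ : Type u} [Ring Λ] [Algebra R Λ]
variable {N : Type u} [AddCommGroup N] [Module Λ N] [Module R N] [IsScalarTower R Λ N]

/-- The quotient map by a `Λ`-submodule, as an `R`-linear map. -/
def mkQR (R : Type u) [CommRing R] [Algebra R Λ] [Module R N] [IsScalarTower R Λ N]
    (S : Submodule Λ N) : N →ₗ[R] N ⧸ S where
  toFun := Submodule.Quotient.mk
  map_add' _ _ := rfl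
  map_smul' _ _ := rfl

lemma mkQR_surjective (S : Submodule Λ N) : Function.Surjective (mkQR R S) :=
  Submodule.Quotient.mk_surjective S

lemma finite_quotient [Module.Finite R N] (S : Submodule Λ N) : Module.Finite R (N ⧸ S) :=
  .of_surjective (mkQR R S) (mkQR_surjective S)

lemma DepthGE.quotient_bot {d : ℕ} (hN : DepthGE R d N) :
    DepthGE R d (N ⧸ (⊥ : Submodule Λ N)) := by
  refine hN.of_retract
    ((Submodule.quotEquivOfEqBot (⊥ : Submodule Λ N) rfl).toLinearMap.restrictScalars R)
    (mkQR R ⊥) fun z => ?_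
  obtain ⟨n, rfl⟩ := Submodule.Quotient.mk_surjective _ z
  rfl

lemma redSub_le_cons (x : R) (xs : List R) : redSub Λ xs N ≤ redSub Λ (x :: xs) N := le_sup_left

/-- The quotient map between successive reductions. -/
def redFactor (x : R) (xs : List R) : (N ⧸ redSub Λ xs N) →ₗ[R] (N ⧸ redSub Λ (x :: xs) N) :=
  (Submodule.mapQ (redSub Λ xs N) (redSub Λ (x :: xs) N) LinearMap.id
    (redSub_le_cons x xs)).restrictScalars R

lemma redFactor_mk (x : R) (xs : List R) (n : N) :
    redFactor x xs (Submodule.Quotient.mk (p := redSub Λ xs N) n) = Submodule.Quotient.mk n := rfl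

lemma redFactor_surjective (x : R) (xs : List R) :
    Function.Surjective (redFactor (Λ := Λ) (N := N) x xs) := by
  intro z
  obtain ⟨n, rfl⟩ := Submodule.Quotient.mk_surjective _ z
  exact ⟨Submodule.Quotient.mk n, rfl⟩

lemma redFactor_exact (x : R) (xs : List R) :
    Function.Exact (LinearMap.lsmul R (N ⧸ redSub Λ xs N) (x ^ 2)) (redFactor x xs) := by
  intro z
  obtain ⟨n, rfl⟩ := Submodule.Quotient.mk_surjective _ z
  rw [redFactor_mk, Submodule.Quotient.mk_eq_zero, mem_redSub_cons]
  constructor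
  · rintro ⟨s, hs, m, rfl⟩
    refine ⟨Submodule.Quotient.mk m, ?_⟩
    rw [LinearMap.lsmul_apply, ← Submodule.Quotient.mk_smul, eq_comm, Submodule.Quotient.eq,
      add_sub_cancel_right]
    exact hs
  · rintro ⟨w, hw⟩
    obtain ⟨m, rfl⟩ := Submodule.Quotient.mk_surjective _ w
    rw [LinearMap.lsmul_apply, ← Submodule.Quotient.mk_smul, eq_comm, Submodule.Quotient.eq] at hw
    exact ⟨_, hw, m, by abel⟩

lemma isSMulRegular_quotient_iff {x : R} {S : Submodule Λ N} :
    IsSMulRegular (N ⧸ S) x ↔ ∀ n : N, x • n ∈ S → n ∈ S := by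
  rw [isSMulRegular_iff_right_eq_zero_of_smul]
  constructor
  · intro h n hn
    rw [← Submodule.Quotient.mk_eq_zero]
    refine h _ ?_
    rwa [← Submodule.Quotient.mk_smul, Submodule.Quotient.mk_eq_zero]
  · intro h z hz
    obtain ⟨n, rfl⟩ := Submodule.Quotient.mk_surjective _ z
    rw [← Submodule.Quotient.mk_smul, Submodule.Quotient.mk_eq_zero] at hz
    rw [Submodule.Quotient.mk_eq_zero]
    exact h n hz

lemma DepthGE.redSub_cons {x : R} {xs : List R} {n : ℕ}
    (h : DepthGE R (n + 1) (N ⧸ redSub Λ xs N)) (hx : ∀ n : N, x • n ∈ redSub Λ xs N →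
      n ∈ redSub Λ xs N) : DepthGE R n (N ⧸ redSub Λ (x :: xs) N) :=
  .of_cokernel (LinearMap.lsmul R (N ⧸ redSub Λ xs N) (x ^ 2)) (redFactor x xs)
    ((isSMulRegular_quotient_iff.2 hx).pow 2) (redFactor_surjective x xs) (redFactor_exact x xs)
    h (h.mono n.le_succ)

lemma supportDim_redSub_cons [Module.Finite R N] {x : R} {xs : List R} (hxm : x ∈ maximalIdeal R)
    (hx : ∀ n : N, x • n ∈ redSub Λ xs N → n ∈ redSub Λ xs N) :
    Module.supportDim R (N ⧸ redSub Λ (x :: xs) N) + 1 ≤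
      Module.supportDim R (N ⧸ redSub Λ xs N) := by
  have := finite_quotient (R := R) (redSub Λ xs N)
  rw [← Module.supportDim_quotSMulTop_succ_eq_supportDim
    ((isSMulRegular_quotient_iff.2 hx).pow 2) (Ideal.pow_mem_of_mem _ hxm 2 two_pos)]
  gcongr
  refine Module.supportDim_le_of_surjective (Submodule.liftQ _ (redFactor x xs) ?_) ?_
  · rintro z hz
    obtain ⟨w, -, rfl⟩ := (Submodule.mem_smul_pointwise_iff_exists _ _ _).1 hz
    exact (redFactor_exact x xs _).2 ⟨w, rfl⟩
  · rw [← LinearMap.range_eq_top, Submodule.range_liftQ, LinearMap.range_eq_top]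
    exact redFactor_surjective x xs

lemma exists_wReg [Module.Finite R N] {d b : ℕ} (hN : DepthGE R d N) (hb : 0 < b) {k : ℕ}
    (hk : k ≤ d) :
    ∃ xs : List R, xs.length = k ∧ (∀ x ∈ xs, ∃ y ∈ maximalIdeal R, x = y ^ b) ∧
      WReg Λ xs N ∧ DepthGE R (d - k) (N ⧸ redSub Λ xs N) ∧
      Module.supportDim R (N ⧸ redSub Λ xs N) + k ≤ Module.supportDim R N := by
  induction k with
  | zero =>
    refine ⟨[], rfl, by simp, trivial, hN.quotient_bot, ?_⟩
    rw [Nat.cast_zero, add_zero]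
    exact Module.supportDim_le_of_surjective (mkQR R _) (mkQR_surjective _)
  | succ k ih =>
    obtain ⟨xs, hlen, hpow, hreg, hdep, hdim⟩ := ih (by omega)
    obtain ⟨m, hm⟩ : ∃ m, d - k = m + 1 := ⟨d - k - 1, by omega⟩
    rw [hm] at hdep
    have := finite_quotient (R := R) (redSub Λ xs N)
    obtain ⟨y, hy, hyreg⟩ := (hdep.mono (by omega)).exists_isSMulRegular
    have hx := isSMulRegular_quotient_iff.1 (hyreg.pow b)
    refine ⟨y ^ b :: xs, by simp [hlen], ?_, ⟨hreg, hx⟩, ?_, ?_⟩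
    · simp only [List.mem_cons, forall_eq_or_imp]
      exact ⟨⟨y, hy, rfl⟩, hpow⟩
    · rw [show d - (k + 1) = m by omega]
      exact hdep.redSub_cons hx
    · refine le_trans ?_ hdim
      have := supportDim_redSub_cons (Ideal.pow_mem_of_mem _ hy b hb) hx
      rw [add_comm k 1, Nat.cast_add, ← add_assoc]
      gcongr
      exact_mod_cast this

lemma isFiniteLength_of_supportDim_le_zero {A : Type u} [AddCommGroup A] [Module R A]
    [Module.Finite R A] (h : Module.supportDim R A ≤ 0) : IsFiniteLength R A := by
  rw [Module.supportDim_eq_ringKrullDim_quotient_annihilator] at h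
  have : Ring.KrullDimLE 0 (R ⧸ Module.annihilator R A) :=
    (Order.krullDimLE_iff 0 _).2 h
  have : IsArtinianRing (R ⧸ Module.annihilator R A) :=
    isArtinianRing_iff_isNoetherianRing_krullDimLE_zero.2 ⟨inferInstance, this⟩
  rw [isFiniteLength_iff_isNoetherian_isArtinian]
  refine ⟨inferInstance, ?_⟩
  have : IsArtinian R (R ⧸ Module.annihilator R A) :=
    isArtinian_of_surjective_algebraMap (S := R) (R := R ⧸ Module.annihilator R A)
      (Ideal.Quotient.mk_surjective (I := Module.annihilator R A))
  let _ : Module (R ⧸ Module.annihilator R A) A := Module.quotientAnnihilator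
  have : IsScalarTower R (R ⧸ Module.annihilator R A) A :=
    ⟨fun r s a => by
      obtain ⟨s, rfl⟩ := Ideal.Quotient.mk_surjective s
      exact mul_smul r s a⟩
  have : Module.Finite (R ⧸ Module.annihilator R A) A :=
    Module.Finite.of_restrictScalars_finite R _ A
  obtain ⟨n, f, hf⟩ := Module.Finite.exists_fin' (R ⧸ Module.annihilator R A) A
  exact isArtinian_of_surjective _ (f.restrictScalars R) hf

/-- Modules whose identity becomes projectively trivial after multiplication by elements of
`𝔪 ^ b` inherit regularity from `Λ`. -/
lemma wReg_of_wReg [Module.Finite R N] {d b : ℕ} (hN : DepthGE R d N)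
    (hPN : ∀ y ∈ maximalIdeal R,
      FactorsThroughProjective Λ (y ^ b • (LinearMap.id : N →ₗ[Λ] N)))
    {xs : List R} (hlen : xs.length ≤ d) (hreg : WReg Λ xs Λ) :
    WReg Λ xs N ∧ DepthGE R (d - xs.length) (N ⧸ redSub Λ xs N) := by
  induction xs with
  | nil =>
    exact ⟨trivial, hN.quotient_bot⟩
  | cons x xs ih =>
    rw [List.length_cons] at hlen
    obtain ⟨h₁, h₂⟩ := ih (by omega) hreg.1
    obtain ⟨m, hm⟩ : ∃ m, d - xs.length = m + 1 := ⟨d - xs.length - 1, by omega⟩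
    rw [hm] at h₂
    have := finite_quotient (R := R) (redSub Λ xs N)
    obtain ⟨y, hy, hyreg⟩ := (h₂.mono (by omega)).exists_isSMulRegular
    have hyreg := isSMulRegular_quotient_iff.1 (hyreg.pow b)
    have hx (n : N) (hn : x • n ∈ redSub Λ xs N) : n ∈ redSub Λ xs N := by
      refine hyreg n ?_
      obtain ⟨κ, c, e, hce⟩ := (hPN y hy).exists_free
      have hce' := hce n
      rw [LinearMap.smul_apply, LinearMap.id_apply] at hce'
      rw [hce', Finsupp.linearCombination_apply]
      refine sum_mem fun i _ => ?_
      refine redSub_map (LinearMap.toSpanSingleton Λ N (e i)) (hreg.2 _ ?_)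
      have := redSub_map ((Finsupp.lapply i : (κ →₀ Λ) →ₗ[Λ] Λ).comp c) hn
      rwa [LinearMap.map_smul_of_tower] at this
    refine ⟨⟨h₁, hx⟩, ?_⟩
    rw [List.length_cons, show d - (xs.length + 1) = m by omega]
    exact h₂.redSub_cons hx

/-- Bound on the length of the reductions. -/
lemma length_quotient_redSub_le [Module.Finite R Λ] {c : ℕ} (p : (Fin c → Λ) →ₗ[Λ] N)
    (hp : Function.Surjective p) (xs : List R) :
    Module.length R (N ⧸ redSub Λ xs N) ≤ Module.length R (Fin c → Λ ⧸ redSub Λ xs Λ) := by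
  let q : (Fin c → Λ ⧸ redSub Λ xs Λ) →ₗ[R] (N ⧸ redSub Λ xs N) :=
    ∑ j, ((redMap xs (LinearMap.toSpanSingleton Λ N (p (Pi.single j (1 : Λ))))).restrictScalars R).comp
      (LinearMap.proj j)
  refine Module.length_le_of_surjective q fun z => ?_
  obtain ⟨n, rfl⟩ := Submodule.Quotient.mk_surjective _ z
  obtain ⟨v, rfl⟩ := hp n
  refine ⟨fun j => Submodule.Quotient.mk (v j), ?_⟩
  simp only [q, LinearMap.sum_apply, LinearMap.comp_apply, LinearMap.proj_apply,
    LinearMap.restrictScalars_apply, redMap_mk, LinearMap.toSpanSingleton_apply]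
  have : v = ∑ j, v j • (Pi.single j 1 : Fin c → Λ) := by
    ext i
    simp [Finset.sum_apply, Pi.single_apply]
  conv_rhs => rw [this, map_sum]
  simp only [map_smul]
  exact (map_sum (redSub Λ xs N).mkQ (fun j => v j • p (Pi.single j 1)) Finset.univ).symm

end RegularSequences

section IndecomposableLattices

variable {R : Type u} [CommRing R] [IsLocalRing R] {Λ : Type u} [Ring Λ] [Algebra R Λ]
variable {ω : Type u} [AddCommGroup ω] [Module R ω]

/-- Indecomposable lattices, bundled. -/
structure IndecLat (R : Type u) [CommRing R] [IsLocalRing R] (Λ : Type u) [Ring Λ] [Algebra R Λ]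
    (ω : Type u) [AddCommGroup ω] [Module R ω] : Type (u + 1) where
  /-- the underlying module -/
  X : Type u
  [addCommGroup : AddCommGroup X]
  [module : Module Λ X]
  [moduleR : Module R X]
  [isScalarTower : IsScalarTower R Λ X]
  lat : IsLattice R Λ ω X
  indec : IsIndecomposable Λ X

attribute [instance] IndecLat.addCommGroup IndecLat.module IndecLat.moduleR IndecLat.isScalarTower

/-- Uniform data allowing to reduce all indecomposable lattices to modules of bounded length. -/
structure IsReductionSequence (R : Type u) [CommRing R] [IsLocalRing R] (Λ : Type u) [Ring Λ]
    [Algebra R Λ] (ω : Type u) [AddCommGroup ω] [Module R ω] (xs : List R) (B : ℕ) : Prop where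
  mem : ∀ x ∈ xs, x ∈ maximalIdeal R
  factors : ∀ N : IndecLat R Λ ω, ∀ x ∈ xs,
    FactorsThroughProjective Λ (x • (LinearMap.id : N.X →ₗ[Λ] N.X))
  wReg : ∀ N : IndecLat R Λ ω, WReg Λ xs N.X
  length_le : ∀ N : IndecLat R Λ ω, Module.length R (N.X ⧸ redSub Λ xs N.X) ≤ B

/-- Composites of at least `n` non-isomorphisms between indecomposable lattices. -/
def NonIsoChain : ℕ → ∀ M N : IndecLat R Λ ω, (M.X →ₗ[Λ] N.X) → Prop
  | 0, _, _, _ => True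
  | n + 1, M, N, f => ∃ (Y : IndecLat R Λ ω) (g : M.X →ₗ[Λ] Y.X) (h : Y.X →ₗ[Λ] N.X),
      ¬ Function.Bijective g ∧ NonIsoChain n Y N h ∧ f = h.comp g

lemma NonIsoChain.split {m n : ℕ} {M N : IndecLat R Λ ω} {f : M.X →ₗ[Λ] N.X}
    (hf : NonIsoChain (m + n) M N f) :
    ∃ (Y : IndecLat R Λ ω) (g : M.X →ₗ[Λ] Y.X) (h : Y.X →ₗ[Λ] N.X),
      NonIsoChain m M Y g ∧ NonIsoChain n Y N h ∧ f = h.comp g := by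
  induction m generalizing M with
  | zero => exact ⟨M, LinearMap.id, f, trivial, by rwa [zero_add] at hf, rfl⟩
  | succ m ih =>
    rw [Nat.succ_add] at hf
    obtain ⟨Z, g, h, hg, hh, rfl⟩ := hf
    obtain ⟨Y, g', h', hg', hh', rfl⟩ := ih hh
    exact ⟨Y, g'.comp g, h', ⟨Z, g, g', hg, hg', rfl⟩, hh', by rw [LinearMap.comp_assoc]⟩

variable [IsNoetherianRing R] [Module.Finite R Λ]

lemma IndecLat.finite (M : IndecLat R Λ ω) : Module.Finite R M.X :=
  have := M.lat.1
  Module.Finite.trans (R := R) Λ M.X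

lemma eq_top_of_forall_sub_mem {M : Type u} [AddCommGroup M] [Module Λ M] [Module R M]
    [IsScalarTower R Λ M] [Module.Finite R M] (S : Submodule Λ M)
    (h : ∀ m, ∃ s ∈ S, m - s ∈ maximalIdeal R • (⊤ : Submodule R M)) : S = ⊤ := by
  have := Submodule.le_of_le_smul_of_le_jacobson_bot (N := S.restrictScalars R)
    (N' := (⊤ : Submodule R M)) (I := maximalIdeal R) Module.Finite.fg_top
    (maximalIdeal_le_jacobson _) (fun m _ => by
      obtain ⟨s, hs, hms⟩ := h m
      rw [← add_sub_cancel s m]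
      exact Submodule.add_mem_sup hs hms)
  exact eq_top_iff.2 fun m _ => this trivial

variable {xs : List R} {B : ℕ}

/-- Reductions of indecomposable lattices are indecomposable. -/
lemma IsReductionSequence.eq_bot_or_eq_bot [IsAdicComplete (maximalIdeal R) R]
    (H : IsReductionSequence R Λ ω xs B) (M : IndecLat R Λ ω)
    (A C : Submodule Λ (M.X ⧸ redSub Λ xs M.X)) (hAC : IsCompl A C) : A = ⊥ ∨ C = ⊥ := by
  have := M.finite
  let S := redSub Λ xs M.X
  let e := A.projection C hAC
  have he (z) : e z ∈ A := Submodule.projection_apply_mem hAC z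
  have he' (z) : z - e z ∈ C := Submodule.sub_projection_mem hAC z
  obtain ⟨χ, hχ⟩ := exists_lift_redSub H.mem (H.factors M) (H.wReg M) (e.comp S.mkQ)
  have top {D : Submodule Λ (M.X ⧸ S)} (h : D.comap S.mkQ = ⊤) : D = ⊤ := by
    rw [eq_top_iff]
    rintro z -
    obtain ⟨m, rfl⟩ := S.mkQ_surjective z
    exact (h.ge trivial : m ∈ D.comap S.mkQ)
  rcases bijective_or_bijective_one_sub (R := R) M.indec χ with h | h
  · right
    have : A = ⊤ := top <| eq_top_of_forall_sub_mem (R := R) _ fun m₀ => by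
      obtain ⟨m, rfl⟩ := h.2 m₀
      obtain ⟨n, hn⟩ := S.mkQ_surjective (e (S.mkQ m))
      exact ⟨n, by rw [Submodule.mem_comap, hn]; exact he _, hχ m n hn.symm⟩
    exact disjoint_top.1 (this ▸ hAC.symm.disjoint)
  · left
    have : C = ⊤ := top <| eq_top_of_forall_sub_mem (R := R) _ fun m₀ => by
      obtain ⟨m, rfl⟩ := h.2 m₀
      obtain ⟨n, hn⟩ := S.mkQ_surjective (e (S.mkQ m))
      refine ⟨m - n, by rw [Submodule.mem_comap, map_sub, hn]; exact he' _, ?_⟩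
      convert neg_mem (hχ m n hn.symm) using 1
      simp only [LinearMap.sub_apply, LinearMap.id_apply]
      abel
    exact disjoint_top.1 (this ▸ hAC.disjoint)

lemma IsReductionSequence.bijective_of_redMap (H : IsReductionSequence R Λ ω xs B)
    {M N : IndecLat R Λ ω} (f : M.X →ₗ[Λ] N.X) (hf : Function.Bijective (redMap xs f)) :
    Function.Bijective f := by
  have := M.finite
  have := N.finite
  let e := LinearEquiv.ofBijective _ hf
  obtain ⟨χ, hχ⟩ := exists_lift_redSub H.mem (H.factors N) (H.wReg M)
    (e.symm.toLinearMap.comp (redSub Λ xs N.X).mkQ)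
  have h₁ : Function.Surjective (χ.comp f) := by
    rw [← LinearMap.range_eq_top]
    refine eq_top_of_forall_sub_mem (R := R) _ fun m => ⟨_, ⟨m, rfl⟩, ?_⟩
    have h := neg_mem (hχ (f m) m ?_)
    · rwa [neg_sub] at h
    exact e.symm_apply_apply ((redSub Λ xs M.X).mkQ m)
  have h₂ : Function.Injective (χ.comp f) :=
    OrzechProperty.injective_of_surjective_endomorphism
      ((χ.comp f).restrictScalars R : M.X →ₗ[R] M.X) h₁
  refine ⟨fun a b hab => h₂ (congrArg χ hab), ?_⟩
  rw [← LinearMap.range_eq_top]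
  refine eq_top_of_forall_sub_mem (R := R) _ fun n => ?_
  obtain ⟨z, hz⟩ := hf.2 (Submodule.Quotient.mk n)
  obtain ⟨m, rfl⟩ := Submodule.Quotient.mk_surjective _ z
  refine ⟨f m, ⟨m, rfl⟩, redSub_le (Λ := Λ) H.mem ?_⟩
  rw [redMap_mk, eq_comm, Submodule.Quotient.eq] at hz
  exact hz

end IndecomposableLattices

section Lengths

variable {R : Type u} [CommRing R] {A Y N : Type u} [AddCommGroup A] [Module R A]
  [AddCommGroup Y] [Module R Y] [AddCommGroup N] [Module R N]

lemma length_eq_ker_add_range (f : A →ₗ[R] Y) :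
    Module.length R A = Module.length R (LinearMap.ker f) + Module.length R (LinearMap.range f) :=
  Module.length_eq_add_of_exact (LinearMap.ker f).subtype f.rangeRestrict
    (Submodule.subtype_injective _) f.surjective_rangeRestrict
    (fun x => by simp [Subtype.ext_iff])

/-- If a composite has the same length as its two factors, then the middle module is the direct
sum of the range of the first and the kernel of the second. -/
lemma range_ker_of_length_le (f : A →ₗ[R] Y) (g : Y →ₗ[R] N) {l : ℕ}
    (hf : Module.length R (LinearMap.range f) ≤ l) (hg : Module.length R (LinearMap.range g) ≤ l)
    (h : l ≤ Module.length R (LinearMap.range (g.comp f))) :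
    (∀ a, g (f a) = 0 → f a = 0) ∧ ∀ y, ∃ a, g y = g (f a) := by
  constructor
  · let q : LinearMap.range f →ₗ[R] N := g.domRestrict (LinearMap.range f)
    have hq : LinearMap.range q = LinearMap.range (g.comp f) := by
      rw [LinearMap.range_comp, LinearMap.range_domRestrict]
    have e := length_eq_ker_add_range q
    rw [hq] at e
    have e₁ : Module.length R (LinearMap.ker q) = 0 := by
      by_contra hne
      have h₁ : (1 : ℕ∞) ≤ Module.length R (LinearMap.ker q) := Order.one_le_iff_ne_zero.2 hne
      have h₂ : 1 + (l : ℕ∞) ≤ l := (add_le_add h₁ h).trans (e.symm.trans_le hf)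
      have : 1 + l ≤ l := by exact_mod_cast h₂
      omega
    have := Module.length_eq_zero_iff.1 e₁
    intro a ha
    have h₃ : (⟨⟨f a, a, rfl⟩, ha⟩ : LinearMap.ker q) = 0 := Subsingleton.elim _ _
    exact congrArg (fun z : LinearMap.ker q => z.1.1) h₃
  · let j : LinearMap.range (g.comp f) →ₗ[R] LinearMap.range g :=
      Submodule.inclusion (LinearMap.range_comp_le_range f g)
    have e := Module.length_eq_add_of_exact j (LinearMap.range j).mkQ
      (Submodule.inclusion_injective _) (Submodule.mkQ_surjective _)
      (LinearMap.exact_map_mkQ_range j)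
    have e₁ : Module.length R (LinearMap.range g ⧸ LinearMap.range j) = 0 := by
      by_contra hne
      have h₁ := Order.one_le_iff_ne_zero.2 hne
      have h₂ : (l : ℕ∞) + 1 ≤ l := (add_le_add h h₁).trans (e.symm.trans_le hg)
      have : l + 1 ≤ l := by exact_mod_cast h₂
      omega
    have := Module.length_eq_zero_iff.1 e₁
    have top := Submodule.Quotient.subsingleton_iff.1 this
    intro y
    obtain ⟨⟨-, a, rfl⟩, ha⟩ := (top.ge trivial : (⟨g y, y, rfl⟩ : LinearMap.range g) ∈ _)
    exact ⟨a, (congrArg Subtype.val ha).symm⟩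

end Lengths

section HaradaSai

variable {R : Type u} [CommRing R] [IsLocalRing R] [IsNoetherianRing R]
  [IsAdicComplete (maximalIdeal R) R]
  {Λ : Type u} [Ring Λ] [Algebra R Λ] [Module.Finite R Λ]
variable {ω : Type u} [AddCommGroup ω] [Module R ω] {xs : List R} {B : ℕ}

/-- The number of non-isomorphisms needed in the Harada–Sai lemma. -/
def haradaSaiBound : ℕ → ℕ
  | 0 => 0
  | k + 1 => haradaSaiBound k + (haradaSaiBound k + 1)

lemma redMap_comp {L M N : Type u}
    [AddCommGroup L] [Module Λ L] [Module R L] [IsScalarTower R Λ L]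
    [AddCommGroup M] [Module Λ M] [Module R M] [IsScalarTower R Λ M]
    [AddCommGroup N] [Module Λ N] [Module R N] [IsScalarTower R Λ N]
    (g : M →ₗ[Λ] N) (f : L →ₗ[Λ] M) (z) :
    redMap xs (g.comp f) z = redMap xs g (redMap xs f z) := by
  obtain ⟨m, rfl⟩ := Submodule.Quotient.mk_surjective _ z
  rfl

/-- The reduction of a map, as an `R`-linear map. -/
abbrev redMapR (xs : List R) {M N : Type u}
    [AddCommGroup M] [Module Λ M] [Module R M] [IsScalarTower R Λ M]
    [AddCommGroup N] [Module Λ N] [Module R N] [IsScalarTower R Λ N] (f : M →ₗ[Λ] N) :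
    (M ⧸ redSub Λ xs M) →ₗ[R] (N ⧸ redSub Λ xs N) :=
  (redMap xs f).restrictScalars R

lemma redMapR_comp {L M N : Type u}
    [AddCommGroup L] [Module Λ L] [Module R L] [IsScalarTower R Λ L]
    [AddCommGroup M] [Module Λ M] [Module R M] [IsScalarTower R Λ M]
    [AddCommGroup N] [Module Λ N] [Module R N] [IsScalarTower R Λ N]
    (g : M →ₗ[Λ] N) (f : L →ₗ[Λ] M) :
    redMapR xs (g.comp f) = (redMapR xs g).comp (redMapR xs f) :=
  LinearMap.ext fun z => redMap_comp g f z

lemma length_range_comp_le_left {A Y N : Type u} [AddCommGroup A] [Module R A]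
    [AddCommGroup Y] [Module R Y] [AddCommGroup N] [Module R N] (f : A →ₗ[R] Y) (g : Y →ₗ[R] N) :
    Module.length R (LinearMap.range (g.comp f)) ≤ Module.length R (LinearMap.range g) :=
  Module.length_le_of_injective (Submodule.inclusion (LinearMap.range_comp_le_range f g))
    (Submodule.inclusion_injective _)

lemma length_range_comp_le_right {A Y N : Type u} [AddCommGroup A] [Module R A]
    [AddCommGroup Y] [Module R Y] [AddCommGroup N] [Module R N] (f : A →ₗ[R] Y) (g : Y →ₗ[R] N) :
    Module.length R (LinearMap.range (g.comp f)) ≤ Module.length R (LinearMap.range f) := by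
  rw [LinearMap.range_comp]
  refine Module.length_le_of_surjective (g.submoduleMap (LinearMap.range f))
    (g.submoduleMap_surjective _)

lemma isCompl_range_ker {A Y N : Type u} [AddCommGroup A] [Module Λ A] [AddCommGroup Y]
    [Module Λ Y] [AddCommGroup N] [Module Λ N] (f : A →ₗ[Λ] Y) (g : Y →ₗ[Λ] N)
    (h : ∀ a, g (f a) = 0 → f a = 0) (h' : ∀ y, ∃ a, g y = g (f a)) :
    IsCompl (LinearMap.range f) (LinearMap.ker g) := by
  constructor
  · rw [Submodule.disjoint_def]
    rintro - ⟨a, rfl⟩ ha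
    exact h a ha
  · rw [codisjoint_iff, eq_top_iff]
    rintro y -
    obtain ⟨a, ha⟩ := h' y
    rw [← add_sub_cancel (f a) y]
    exact Submodule.add_mem_sup ⟨a, rfl⟩ (by rw [LinearMap.mem_ker, map_sub, ha, sub_self])

/-- The **Harada–Sai lemma** for reductions of indecomposable lattices. -/
lemma IsReductionSequence.length_range_le (H : IsReductionSequence R Λ ω xs B) (k : ℕ)
    {M N : IndecLat R Λ ω} (f : M.X →ₗ[Λ] N.X) (hf : NonIsoChain (haradaSaiBound k) M N f) :
    Module.length R (LinearMap.range (redMapR xs f)) ≤ (B - k : ℕ) := by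
  induction k generalizing M N with
  | zero =>
    exact (Module.length_le_of_injective _ (Submodule.subtype_injective _)).trans (H.length_le N)
  | succ k ih =>
    obtain ⟨Y, f₁, h, hf₁, ⟨Z, g, f₂, hg, hf₂, rfl⟩, rfl⟩ := hf.split
    have i₁ := ih f₁ hf₁
    have i₂ := ih f₂ hf₂
    by_contra! hlt
    set l := B - k
    have hl : (l : ℕ∞) ≤
        Module.length R (LinearMap.range (redMapR xs ((f₂.comp g).comp f₁))) := by
      rcases Nat.eq_zero_or_pos l with h0 | h0
      · rw [h0]; exact bot_le
      · have := Order.add_one_le_of_lt hlt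
        rw [show l = B - (k + 1) + 1 by omega]
        exact_mod_cast this
    obtain ⟨z, hz⟩ : ∃ z, redMap xs f₂ (redMap xs g (redMap xs f₁ z)) ≠ 0 := by
      by_contra! h0
      have : redMapR xs ((f₂.comp g).comp f₁) = 0 := LinearMap.ext fun z => by
        rw [LinearMap.restrictScalars_apply, redMap_comp, redMap_comp, h0, LinearMap.zero_apply]
      have h1 : Module.length R (LinearMap.range (redMapR xs ((f₂.comp g).comp f₁))) = 0 := by
        rw [this, LinearMap.range_zero]
        exact Module.length_eq_zero
      rw [h1] at hlt
      exact not_lt_bot hlt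
    have i₃ : Module.length R (LinearMap.range (redMapR xs (f₂.comp g))) ≤ l := by
      rw [redMapR_comp]
      exact (length_range_comp_le_left _ _).trans i₂
    have i₄ : Module.length R (LinearMap.range (redMapR xs (g.comp f₁))) ≤ l := by
      rw [redMapR_comp]
      exact (length_range_comp_le_right _ _).trans i₁
    obtain ⟨a₁, a₂⟩ := range_ker_of_length_le _ _ i₁ i₃ (by rwa [redMapR_comp] at hl)
    obtain ⟨b₁, b₂⟩ := range_ker_of_length_le _ _ i₄ i₂
      (by rwa [LinearMap.comp_assoc, redMapR_comp] at hl)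
    have c₁ := H.eq_bot_or_eq_bot Y _ _ (isCompl_range_ker (redMap xs f₁)
      (redMap xs (f₂.comp g)) a₁ a₂)
    have c₂ := H.eq_bot_or_eq_bot Z _ _ (isCompl_range_ker (redMap xs (g.comp f₁))
      (redMap xs f₂) b₁ b₂)
    have c₁ : LinearMap.ker (redMap xs (f₂.comp g)) = ⊥ := c₁.resolve_left fun h => hz <| by
      rw [LinearMap.range_eq_bot.1 h, LinearMap.zero_apply, map_zero, map_zero]
    have c₂ : LinearMap.ker (redMap xs f₂) = ⊥ := c₂.resolve_left fun h => hz <| by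
      rw [← redMap_comp g, LinearMap.range_eq_bot.1 h, LinearMap.zero_apply, map_zero]
    refine hg (H.bijective_of_redMap g ⟨?_, fun w => ?_⟩)
    · rw [injective_iff_map_eq_zero]
      intro y hy
      refine LinearMap.ker_eq_bot'.1 c₁ y ?_
      rw [redMap_comp, hy, map_zero]
    · obtain ⟨v, hv⟩ := b₂ w
      refine ⟨redMap xs f₁ v, ?_⟩
      rw [← redMap_comp]
      exact (LinearMap.ker_eq_bot.1 c₂ hv).symm

lemma IsReductionSequence.mem_redSub (H : IsReductionSequence R Λ ω xs B)
    {M N : IndecLat R Λ ω} (f : M.X →ₗ[Λ] N.X) (hf : NonIsoChain (haradaSaiBound B) M N f)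
    (m : M.X) : f m ∈ redSub Λ xs N.X := by
  have h := H.length_range_le B f hf
  rw [Nat.sub_self, Nat.cast_zero, nonpos_iff_eq_zero, Module.length_eq_zero_iff] at h
  have h₁ : (⟨redMapR xs f (Submodule.Quotient.mk m), _, rfl⟩ :
    LinearMap.range (redMapR xs f)) = 0 := Subsingleton.elim _ _
  rw [← Submodule.Quotient.mk_eq_zero]
  exact congrArg Subtype.val h₁

end HaradaSai

section Extensions

variable {R : Type u} [CommRing R] {Λ : Type u} [Ring Λ] [Algebra R Λ]
variable {K P M Y : Type u}
  [AddCommGroup K] [Module Λ K] [Module R K] [IsScalarTower R Λ K]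
  [AddCommGroup P] [Module Λ P] [Module R P] [IsScalarTower R Λ P]
  [AddCommGroup M] [Module Λ M] [Module R M] [IsScalarTower R Λ M]
  [AddCommGroup Y] [Module Λ Y] [Module R Y] [IsScalarTower R Λ Y]

/-- Factoring a map through an injective one. -/
lemma exists_factor_of_range_le {i : K →ₗ[Λ] P} (hi : Function.Injective i) (f : M →ₗ[Λ] P)
    (h : ∀ m, f m ∈ LinearMap.range i) : ∃ g : M →ₗ[Λ] K, i.comp g = f := by
  refine ⟨(LinearEquiv.ofInjective i hi).symm.toLinearMap.comp (f.codRestrict _ h),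
    LinearMap.ext fun m => ?_⟩
  have : i ((LinearEquiv.ofInjective i hi).symm (f.codRestrict _ h m)) = f m := by simp
  exact this

/-- Factoring a map through a surjective one. -/
lemma exists_factor_of_ker_le {q : P →ₗ[Λ] M} (hq : Function.Surjective q) (f : P →ₗ[Λ] Y)
    (h : ∀ p, q p = 0 → f p = 0) : ∃ g : M →ₗ[Λ] Y, g.comp q = f := by
  refine ⟨((LinearMap.ker q).liftQ f h).comp (q.quotKerEquivOfSurjective hq).symm.toLinearMap,
    LinearMap.ext fun p => ?_⟩
  have : (q.quotKerEquivOfSurjective hq).symm (q p) = Submodule.Quotient.mk p := by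
    rw [LinearEquiv.symm_apply_eq]
    rfl
  rw [LinearMap.comp_apply, LinearMap.comp_apply, LinearEquiv.coe_coe, this]
  rfl

lemma exists_retraction_of_section {i : K →ₗ[Λ] P} {q : P →ₗ[Λ] M} (hi : Function.Injective i)
    (hiq : Function.Exact i q) (s : M →ₗ[Λ] P) (hs : q.comp s = LinearMap.id) :
    ∃ r : P →ₗ[Λ] K, r.comp i = LinearMap.id := by
  have hs' (m : M) : q (s m) = m := LinearMap.congr_fun hs m
  obtain ⟨r, hr⟩ := exists_factor_of_range_le hi (LinearMap.id - s.comp q) fun p =>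
    (hiq _).1 (by simp [hs'])
  refine ⟨r, LinearMap.ext fun k => hi ?_⟩
  have := LinearMap.congr_fun hr (i k)
  simpa [hiq.apply_apply_eq_zero] using this

/-- Pushout of an extension. -/
lemma exists_pushout {i : K →ₗ[Λ] P} {q : P →ₗ[Λ] M} (hi : Function.Injective i)
    (hq : Function.Surjective q) (hiq : Function.Exact i q) (u : K →ₗ[Λ] Y) :
    ∃ (E : Type u) (_ : AddCommGroup E) (_ : Module Λ E) (_ : Module R E)
      (_ : IsScalarTower R Λ E) (θ : Y →ₗ[Λ] E) (π : E →ₗ[Λ] M) (p : P →ₗ[Λ] E),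
      Function.Injective θ ∧ Function.Surjective π ∧ Function.Exact θ π ∧ p.comp i = θ.comp u ∧
      π.comp p = q ∧ ∀ w : P →ₗ[Λ] E, w.comp i = θ.comp u →
        ∃ φ : E →ₗ[Λ] E, φ.comp θ = θ ∧ φ.comp p = w := by
  let D : Submodule Λ (Y × P) := LinearMap.range (u.prod (-i))
  have hD (z : Y × P) : z ∈ D ↔ ∃ k, u k = z.1 ∧ -i k = z.2 := by
    simp [D, Prod.ext_iff]
  let π : (Y × P) ⧸ D →ₗ[Λ] M := D.liftQ (q.comp (LinearMap.snd Λ Y P)) (by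
    rintro - ⟨k, rfl⟩
    simp [hiq.apply_apply_eq_zero])
  have hπ (y : Y) (p : P) : π (D.mkQ (y, p)) = q p := rfl
  refine ⟨(Y × P) ⧸ D, inferInstance, inferInstance, inferInstance, inferInstance,
    D.mkQ.comp (LinearMap.inl Λ Y P), π, D.mkQ.comp (LinearMap.inr Λ Y P), ?_, ?_, ?_, ?_, ?_, ?_⟩
  · rw [injective_iff_map_eq_zero]
    intro y hy
    rw [LinearMap.comp_apply, Submodule.mkQ_apply, Submodule.Quotient.mk_eq_zero, hD] at hy
    obtain ⟨k, hk, hk'⟩ := hy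
    have : k = 0 := hi (by simpa using hk')
    rw [this, map_zero] at hk
    exact hk.symm
  · intro m
    obtain ⟨p, rfl⟩ := hq m
    exact ⟨D.mkQ (0, p), hπ 0 p⟩
  · intro z
    obtain ⟨⟨y, p⟩, rfl⟩ := D.mkQ_surjective z
    rw [hπ]
    constructor
    · intro hp
      obtain ⟨k, rfl⟩ := (hiq p).1 hp
      refine ⟨y + u k, ?_⟩
      rw [LinearMap.comp_apply, Submodule.mkQ_apply, Submodule.mkQ_apply, Submodule.Quotient.eq, hD]
      exact ⟨k, by simp, by simp⟩
    · rintro ⟨y', hy'⟩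
      have := congrArg π hy'
      rw [hπ] at this
      rw [← this]
      exact (hπ y' 0).trans (map_zero q)
  · ext k
    rw [LinearMap.comp_apply, LinearMap.comp_apply, LinearMap.comp_apply, LinearMap.comp_apply,
      Submodule.mkQ_apply, Submodule.mkQ_apply, Submodule.Quotient.eq, hD]
    exact ⟨-k, by simp, by simp⟩
  · rfl
  · intro w hw
    refine ⟨D.liftQ ((D.mkQ.comp (LinearMap.inl Λ Y P)).coprod w) ?_, ?_, ?_⟩
    · rintro - ⟨k, rfl⟩
      have : w (i k) = D.mkQ (u k, 0) := LinearMap.congr_fun hw k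
      simp [this]
    · ext y
      simp
    · ext p
      simp [← Prod.zero_eq_mk]

lemma exists_extension_of_ext1Vanishes (R : Type u) [CommRing R] {Λ : Type u} [Ring Λ]
    [Algebra R Λ] {K P M Y : Type u} [AddCommGroup K] [Module Λ K] [Module R K]
    [IsScalarTower R Λ K] [AddCommGroup P] [Module Λ P] [Module R P] [IsScalarTower R Λ P]
    [AddCommGroup M] [Module Λ M] [Module R M] [IsScalarTower R Λ M]
    [AddCommGroup Y] [Module Λ Y] [Module R Y] [IsScalarTower R Λ Y] {i : K →ₗ[Λ] P} {q : P →ₗ[Λ] M}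
    (hi : Function.Injective i) (hq : Function.Surjective q) (hiq : Function.Exact i q)
    (h : Ext1Vanishes Λ M Y) (u : K →ₗ[Λ] Y) : ∃ v : P →ₗ[Λ] Y, v.comp i = u := by
  obtain ⟨E, _, _, _, _, θ, π, p, hθ, hπ, hθπ, e₁, -⟩ := exists_pushout (R := R) hi hq hiq u
  obtain ⟨s, hs⟩ := h E _ _ π hπ ⟨(LinearEquiv.ofEq _ _ (LinearMap.exact_iff.1 hθπ)).trans
    (LinearEquiv.ofInjective θ hθ).symm⟩
  obtain ⟨r, hr⟩ := exists_retraction_of_section hθ hθπ s hs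
  exact ⟨r.comp p, by rw [LinearMap.comp_assoc, e₁, ← LinearMap.comp_assoc, hr, LinearMap.id_comp]⟩

/-- Maps out of `M` lift along `π` if maps from its syzygy to `ker π` extend. -/
lemma exists_lift_of_extension [Module.Projective Λ P] {i : K →ₗ[Λ] P} {q : P →ₗ[Λ] M}
    (hq : Function.Surjective q) (hiq : Function.Exact i q)
    {L : Type u} [AddCommGroup L] [Module Λ L] {π : L →ₗ[Λ] Y} (hπ : Function.Surjective π)
    (h : ∀ u : K →ₗ[Λ] LinearMap.ker π, ∃ v : P →ₗ[Λ] LinearMap.ker π, v.comp i = u)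
    (f : M →ₗ[Λ] Y) : ∃ g : M →ₗ[Λ] L, π.comp g = f := by
  obtain ⟨w, hw⟩ := Module.projective_lifting_property π (f.comp q) hπ
  have hw' (p : P) : π (w p) = f (q p) := LinearMap.congr_fun hw p
  obtain ⟨v, hv⟩ := h ((w.comp i).codRestrict _ fun k => by
    simp [hw', hiq.apply_apply_eq_zero])
  have hv' (k : K) : (v (i k) : L) = w (i k) := congrArg Subtype.val (LinearMap.congr_fun hv k)
  obtain ⟨g, hg⟩ := exists_factor_of_ker_le hq (w - (LinearMap.ker π).subtype.comp v)
    fun p hp => by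
      obtain ⟨k, rfl⟩ := (hiq p).1 hp
      simp [hv']
  refine ⟨g, LinearMap.ext fun m => ?_⟩
  obtain ⟨p, rfl⟩ := hq m
  have := congrArg π (LinearMap.congr_fun hg p)
  simpa [hw'] using this

end Extensions

section LatApproximation

variable {R : Type u} [CommRing R] [IsLocalRing R] [IsNoetherianRing R]
  {Λ : Type u} [Ring Λ] [Algebra R Λ] [Module.Finite R Λ]
variable {ω : Type u} [AddCommGroup ω] [Module R ω]

lemma IsLattice.exists_presentation {d : ℕ} (hd : ringKrullDim R = d) (hΛ : IsLattice R Λ ω Λ)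
    {M : Type u} [AddCommGroup M] [Module Λ M] [Module R M] [IsScalarTower R Λ M]
    (hM : IsLattice R Λ ω M) :
    ∃ (n : ℕ) (q : (Fin n → Λ) →ₗ[Λ] M), Function.Surjective q ∧ IsLattice R Λ ω (Fin n → Λ) := by
  obtain ⟨_, _, -⟩ := (isLattice_iff hd).1 hM
  obtain ⟨n, q, hq⟩ := Module.Finite.exists_fin' Λ M
  refine ⟨n, q, hq, hΛ.pi hd ?_⟩
  rintro rfl
  exact not_subsingleton M hq.subsingleton

lemma HasLatInjResOfLength.exists_extension {d : ℕ} (hd : ringKrullDim R = d)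
    (hΛ : IsLattice R Λ ω Λ) (t : ℕ) {K P M Y : Type u}
    [AddCommGroup K] [Module Λ K] [Module R K] [IsScalarTower R Λ K]
    [AddCommGroup P] [Module Λ P] [Module R P] [IsScalarTower R Λ P]
    [AddCommGroup M] [Module Λ M] [Module R M] [IsScalarTower R Λ M]
    [AddCommGroup Y] [Module Λ Y] [Module R Y] [IsScalarTower R Λ Y]
    (hY : HasLatInjResOfLength R Λ ω t Y) {i : K →ₗ[Λ] P} {q : P →ₗ[Λ] M}
    (hi : Function.Injective i) (hq : Function.Surjective q) (hiq : Function.Exact i q)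
    (hP : IsLattice R Λ ω P) (hM : IsLattice R Λ ω M) (u : K →ₗ[Λ] Y) :
    ∃ v : P →ₗ[Λ] Y, v.comp i = u := by
  induction t generalizing K P M Y with
  | zero => exact exists_extension_of_ext1Vanishes R hi hq hiq (hY.2 M _ _ _ _ hM) u
  | succ t ih =>
    obtain ⟨L, _, _, _, _, π, hL, hπ, hker⟩ := hY
    cases subsingleton_or_nontrivial K with
    | inl _ => exact ⟨0, LinearMap.ext fun k => by rw [Subsingleton.elim k 0, map_zero, map_zero]⟩
    | inr _ =>
      have hK := IsLattice.of_kernel hd i q hi hq hiq hP hM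
      obtain ⟨n, q', hq', hP'⟩ := IsLattice.exists_presentation hd hΛ hK
      obtain ⟨g, hg⟩ := exists_lift_of_extension hq' (LinearMap.exact_subtype_ker_map q') hπ
        (fun u' => ih hker (Submodule.subtype_injective _) hq'
          (LinearMap.exact_subtype_ker_map q') hP' hK u') u
      obtain ⟨v, hv⟩ := exists_extension_of_ext1Vanishes R hi hq hiq
        (hL.2 M _ _ _ _ hM) g
      exact ⟨π.comp v, by rw [LinearMap.comp_assoc, hv, hg]⟩

lemma IsMinimalLatApprox.exists_lift {d : ℕ} (hd : ringKrullDim R = d)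
    (hΛ : IsLattice R Λ ω Λ) {G C M : Type u}
    [AddCommGroup G] [Module Λ G] [Module R G] [IsScalarTower R Λ G]
    [AddCommGroup C] [Module Λ C]
    [AddCommGroup M] [Module Λ M] [Module R M] [IsScalarTower R Λ M]
    {α : G →ₗ[Λ] C} (hα : IsMinimalLatApprox R Λ ω α) (hM : IsLattice R Λ ω M)
    (f : M →ₗ[Λ] C) : ∃ g : M →ₗ[Λ] G, α.comp g = f := by
  obtain ⟨n, q, hq, hP⟩ := IsLattice.exists_presentation hd hΛ hM
  obtain ⟨t, ht⟩ := hα.2.2.1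
  exact exists_lift_of_extension hq (LinearMap.exact_subtype_ker_map q) hα.2.1
    (fun u => ht.exists_extension hd hΛ t (Submodule.subtype_injective _) hq
      (LinearMap.exact_subtype_ker_map q) hP hM u) f

end LatApproximation

section LengthBound

variable {R : Type u} [CommRing R] [IsLocalRing R]

lemma smul_eq_zero_of_length_le (n : ℕ) {A : Type u} [AddCommGroup A] [Module R A]
    (h : Module.length R A ≤ n) {r : R} (hr : r ∈ maximalIdeal R ^ n) (a : A) : r • a = 0 := by
  induction n generalizing A r with
  | zero =>
    have : Subsingleton A := Module.length_eq_zero_iff.1 (by simpa using h)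
    exact Subsingleton.elim _ _
  | succ n ih =>
    cases subsingleton_or_nontrivial A with
    | inl _ => exact Subsingleton.elim _ _
    | inr _ =>
      have hfin : IsFiniteLength R A :=
        Module.length_ne_top_iff.1 (ne_top_of_le_ne_top (ENat.natCast_ne_top _) h)
      obtain ⟨_, _⟩ := isFiniteLength_iff_isNoetherian_isArtinian.1 hfin
      let S : Submodule R A := maximalIdeal R • ⊤
      have hS : S ≠ ⊤ := fun hS => top_ne_bot (α := Submodule R A)
        (Submodule.eq_bot_of_le_smul_of_le_jacobson_bot _ _ (IsNoetherian.noetherian _) hS.ge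
          (maximalIdeal_le_jacobson _))
      have hlen : Module.length R S ≤ n := by
        refine ENat.lt_natCast_add_one_iff.1 ((Submodule.length_lt hS).trans_le ?_)
        exact_mod_cast h
      rw [pow_succ] at hr
      refine Submodule.mul_induction_on hr (fun s hs t ht => ?_) fun s t hs ht => ?_
      · have := ih hlen hs ⟨t • a, Submodule.smul_mem_smul ht trivial⟩
        rw [mul_smul]
        exact congrArg Subtype.val this
      · rw [add_smul, hs, ht, add_zero]

variable {Λ : Type u} [Ring Λ] [Algebra R Λ]
variable {M : Type u} [AddCommGroup M] [Module Λ M] [Module R M] [IsScalarTower R Λ M]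
  {G : Type u} [AddCommGroup G] [Module Λ G] [Module R G] [IsScalarTower R Λ G]

lemma length_stableHom_le {b : ℕ} (h : hLength R Λ M G < (b : WithBot ℕ∞)) :
    Module.length R (stableHom R Λ M (M × G)) ≤ b := by
  have h' : (Module.length R (stableHom R Λ M (M × G)) : WithBot ℕ∞) < (b : WithBot ℕ∞) := by
    rw [Module.coe_length]
    exact h
  exact_mod_cast h'.le

lemma factorsThroughProjective_smul_id {b : ℕ}
    (h : Module.length R (stableHom R Λ M (M × G)) ≤ b) {r : R} (hr : r ∈ maximalIdeal R ^ b) :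
    FactorsThroughProjective Λ (r • (LinearMap.id : M →ₗ[Λ] M)) := by
  have h₀ := smul_eq_zero_of_length_le b h hr
    ((projTrivial R Λ M (M × G)).mkQ (LinearMap.inl Λ M G))
  have h₁ : r • LinearMap.inl Λ M G ∈ projTrivial R Λ M (M × G) :=
    (Submodule.Quotient.mk_eq_zero _).1 h₀
  have h₂ : FactorsThroughProjective Λ (r • LinearMap.inl Λ M G) := h₁
  have := h₂.postcomp (LinearMap.fst Λ M G)
  convert this using 1
  ext m
  simp

end LengthBound

section Simples

variable {R : Type u} [CommRing R] [IsLocalRing R] [IsNoetherianRing R]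
  [IsAdicComplete (maximalIdeal R) R] {Λ : Type u} [Ring Λ] [Algebra R Λ]
variable {M : Type u} [AddCommGroup M] [Module Λ M] [Module R M] [IsScalarTower R Λ M]
  [Module.Finite R M]

lemma IsIndecomposable.bijective_of_comp_eq (R : Type u) [CommRing R] [IsLocalRing R]
    [IsNoetherianRing R] [IsAdicComplete (maximalIdeal R) R] [Algebra R Λ] [Module R M]
    [IsScalarTower R Λ M] [Module.Finite R M]
    (hM : IsIndecomposable Λ M) {T : Type u} [AddCommGroup T]
    [Module Λ T] {q : M →ₗ[Λ] T} (hq : q ≠ 0) {g : M →ₗ[Λ] M} (h : q.comp g = q) :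
    Function.Bijective g := by
  refine (bijective_or_bijective_one_sub (R := R) hM g).resolve_right fun hg => hq ?_
  ext m
  obtain ⟨m', rfl⟩ := hg.2 m
  have := LinearMap.congr_fun h m'
  simpa [sub_eq_zero] using this.symm

lemma IsIndecomposable.eq_zero_of_factorsThroughProjective (R : Type u) [CommRing R]
    [IsLocalRing R] [IsNoetherianRing R] [IsAdicComplete (maximalIdeal R) R] [Algebra R Λ]
    [Module R M] [IsScalarTower R Λ M] [Module.Finite R M]
    (hM : IsIndecomposable Λ M) (hproj : ¬ Module.Projective Λ M) {T : Type u} [AddCommGroup T]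
    [Module Λ T] [IsSimpleModule Λ T] {f : M →ₗ[Λ] T} (hf : FactorsThroughProjective Λ f) :
    f = 0 := by
  by_contra hne
  obtain ⟨κ, c, e, hce⟩ := hf.exists_free
  obtain ⟨m, hm⟩ : ∃ m, f m ≠ 0 := by
    by_contra! h
    exact hne (LinearMap.ext h)
  obtain ⟨k, hk⟩ : ∃ k, c m k • e k ≠ 0 := by
    by_contra! h
    exact hm (by rw [hce, Finsupp.linearCombination_apply]; exact Finset.sum_eq_zero fun k _ => h k)
  let s : Λ →ₗ[Λ] T := LinearMap.toSpanSingleton Λ T (e k)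
  let ck : M →ₗ[Λ] Λ := (Finsupp.lapply k).comp c
  have hq : s.comp ck ≠ 0 := fun h => hk (LinearMap.congr_fun h m)
  obtain ⟨t, ht⟩ := Module.projective_lifting_property (s.comp ck) s
    (LinearMap.surjective_of_ne_zero hq)
  have hbij : Function.Bijective (t.comp ck) := by
    refine hM.bijective_of_comp_eq R hq ?_
    rw [← LinearMap.comp_assoc, ht]
  let E := LinearEquiv.ofBijective _ hbij
  refine hproj (projective_of_factorsThroughProjective_id ?_)
  refine ⟨Λ, _, _, inferInstance, ck, E.symm.toLinearMap.comp t, LinearMap.ext fun m => ?_⟩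
  exact E.symm_apply_apply m

omit [Module.Finite R M] in
lemma exists_surjective_simple [Module.Finite Λ M] {ι : Type u} {Sfam : ι → Type u}
    [∀ i, AddCommGroup (Sfam i)] [∀ i, Module Λ (Sfam i)]
    (hS : ∀ (T : Type u) (_ : AddCommGroup T) (_ : Module Λ T),
      IsSimpleModule Λ T → ∃ i, Nonempty (T ≃ₗ[Λ] Sfam i))
    {U : Submodule Λ M} (hU : U ≠ ⊤) :
    ∃ (i : ι) (q : M →ₗ[Λ] Sfam i), Function.Surjective q ∧ ∀ u ∈ U, q u = 0 := by
  obtain ⟨C, hC, hUC⟩ := (IsCoatomic.eq_top_or_exists_le_coatom U).resolve_left hU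
  obtain ⟨i, ⟨e⟩⟩ := hS (M ⧸ C) _ _ (isSimpleModule_iff_isCoatom.2 hC)
  refine ⟨i, e.toLinearMap.comp C.mkQ, e.surjective.comp C.mkQ_surjective, fun u hu => ?_⟩
  simp [(Submodule.Quotient.mk_eq_zero C).2 (hUC hu)]

variable {ι : Type u} {Sfam : ι → Type u} [∀ i, AddCommGroup (Sfam i)] [∀ i, Module Λ (Sfam i)]
variable {G : Type u} [AddCommGroup G] [Module Λ G] [Module R G] [IsScalarTower R Λ G]

/-- Maps `M → M ⊕ G` whose composite to the sum of the simples vanishes on `U`. -/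
def vanishingOn (R : Type u) [CommRing R] [Algebra R Λ] [Module R M] [IsScalarTower R Λ M]
    [Module R G] [IsScalarTower R Λ G] (α : G →ₗ[Λ] ∀ i, Sfam i) (U : Submodule Λ M) :
    Submodule R (M →ₗ[Λ] (M × G)) where
  carrier := {f | ∀ u ∈ U, α (f u).2 = 0}
  zero_mem' _ _ := by simp
  add_mem' {f g} hf hg u hu := by simp [hf u hu, hg u hu]
  smul_mem' r f hf u hu := by
    have : (r • f) u = algebraMap R Λ r • f u := (algebraMap_smul Λ r (f u)).symm
    rw [this, Prod.smul_snd, map_smul, hf u hu, smul_zero]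

lemma projTrivial_le_vanishingOn (hM : IsIndecomposable Λ M) (hproj : ¬ Module.Projective Λ M)
    (hsimple : ∀ i, IsSimpleModule Λ (Sfam i)) (α : G →ₗ[Λ] ∀ i, Sfam i) (U : Submodule Λ M) :
    projTrivial R Λ M (M × G) ≤ vanishingOn R α U := by
  intro f hf u _
  have hf' : FactorsThroughProjective Λ f := hf
  ext i
  have := hM.eq_zero_of_factorsThroughProjective R hproj
    (hf'.postcomp (((LinearMap.proj i).comp α).comp (LinearMap.snd Λ M G)))
  exact LinearMap.congr_fun this u

lemma exists_vanishingOn_lt (hM : IsIndecomposable Λ M) (hproj : ¬ Module.Projective Λ M)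
    (hsimple : ∀ i, IsSimpleModule Λ (Sfam i))
    (hS : ∀ (T : Type u) (_ : AddCommGroup T) (_ : Module Λ T),
      IsSimpleModule Λ T → ∃ i, Nonempty (T ≃ₗ[Λ] Sfam i))
    {α : G →ₗ[Λ] ∀ i, Sfam i}
    (hlift : ∀ f : M →ₗ[Λ] (∀ i, Sfam i), ∃ g : M →ₗ[Λ] G, α.comp g = f) [Module.Finite Λ M]
    {U : Submodule Λ M} (hU : U ≠ ⊤) :
    ∃ m, (vanishingOn R α (U ⊔ Submodule.span Λ {m})).map (projTrivial R Λ M (M × G)).mkQ <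
      (vanishingOn R α U).map (projTrivial R Λ M (M × G)).mkQ := by
  classical
  obtain ⟨i, q, hq, hqU⟩ := exists_surjective_simple hS hU
  obtain ⟨g, hg⟩ := hlift ((LinearMap.single Λ Sfam i).comp q)
  have hg' (m : M) : α (g m) = Pi.single i (q m) := LinearMap.congr_fun hg m
  have := hsimple i
  have := IsSimpleModule.nontrivial Λ (Sfam i)
  obtain ⟨s, hs⟩ := exists_ne (0 : Sfam i)
  obtain ⟨m, rfl⟩ := hq s
  let U' := U ⊔ Submodule.span Λ {m}
  have hle : vanishingOn R α U' ≤ vanishingOn R α U := fun f hf u hu =>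
    hf u (Submodule.mem_sup_left hu)
  have hf : (LinearMap.inr Λ M G).comp g ∈ vanishingOn R α U := fun u hu => by
    simp [hg', hqU u hu]
  have hf' : (LinearMap.inr Λ M G).comp g ∉ vanishingOn R α U' := fun h => hs <| by
    have := h m (Submodule.mem_sup_right (Submodule.mem_span_singleton_self m))
    simpa [hg'] using this
  refine ⟨m, ?_⟩
  refine lt_of_le_of_ne (Submodule.map_mono hle) fun h => hf' ?_
  have h₁ : (projTrivial R Λ M (M × G)).mkQ ((LinearMap.inr Λ M G).comp g) ∈
      (vanishingOn R α U').map (projTrivial R Λ M (M × G)).mkQ := by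
    rw [h]
    exact Submodule.mem_map_of_mem hf
  obtain ⟨f', hf'', e⟩ := h₁
  have h₂ := projTrivial_le_vanishingOn (R := R) hM hproj hsimple α U'
    ((Submodule.Quotient.eq _).1 e)
  simpa using sub_mem hf'' h₂

/-- Generating sets of bounded size for non-projective indecomposables. -/
lemma exists_generators (hM : IsIndecomposable Λ M) (hproj : ¬ Module.Projective Λ M)
    (hsimple : ∀ i, IsSimpleModule Λ (Sfam i))
    (hS : ∀ (T : Type u) (_ : AddCommGroup T) (_ : Module Λ T),
      IsSimpleModule Λ T → ∃ i, Nonempty (T ≃ₗ[Λ] Sfam i))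
    {α : G →ₗ[Λ] ∀ i, Sfam i}
    (hlift : ∀ f : M →ₗ[Λ] (∀ i, Sfam i), ∃ g : M →ₗ[Λ] G, α.comp g = f) [Module.Finite Λ M]
    (n : ℕ) (U : Submodule Λ M)
    (hn : Module.length R ((vanishingOn R α U).map (projTrivial R Λ M (M × G)).mkQ) ≤ n) :
    ∃ v : Fin n → M, U ⊔ Submodule.span Λ (Set.range v) = ⊤ := by
  have key (U : Submodule Λ M) (hU : U ≠ ⊤) (n : ℕ)
      (hn : Module.length R ((vanishingOn R α U).map (projTrivial R Λ M (M × G)).mkQ) ≤ n) :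
      ∃ m, Module.length R ((vanishingOn R α (U ⊔ Submodule.span Λ {m})).map
        (projTrivial R Λ M (M × G)).mkQ) < n := by
    obtain ⟨m, hlt⟩ := exists_vanishingOn_lt (R := R) hM hproj hsimple hS hlift hU
    rw [Module.length_submodule] at hn
    refine ⟨m, ?_⟩
    rw [Module.length_submodule]
    exact (Order.height_strictMono hlt (lt_of_le_of_lt (Order.height_mono hlt.le)
      (hn.trans_lt (ENat.natCast_lt_top n)))).trans_le hn
  induction n generalizing U with
  | zero =>
    by_cases hU : U = ⊤
    · exact ⟨0, by rw [hU, top_sup_eq]⟩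
    · obtain ⟨m, hm⟩ := key U hU 0 hn
      simp at hm
  | succ n ih =>
    by_cases hU : U = ⊤
    · exact ⟨0, by rw [hU, top_sup_eq]⟩
    obtain ⟨m, hm⟩ := key U hU _ hn
    obtain ⟨v, hv⟩ := ih _ (ENat.lt_natCast_add_one_iff.1 (by exact_mod_cast hm))
    exact ⟨Fin.cons m v, by rw [Fin.range_cons, Set.insert_eq, Submodule.span_union,
      ← sup_assoc, hv]⟩

lemma exists_surjective_of_length_le (hM : IsIndecomposable Λ M) (hproj : ¬ Module.Projective Λ M)
    (hsimple : ∀ i, IsSimpleModule Λ (Sfam i))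
    (hS : ∀ (T : Type u) (_ : AddCommGroup T) (_ : Module Λ T),
      IsSimpleModule Λ T → ∃ i, Nonempty (T ≃ₗ[Λ] Sfam i))
    {α : G →ₗ[Λ] ∀ i, Sfam i}
    (hlift : ∀ f : M →ₗ[Λ] (∀ i, Sfam i), ∃ g : M →ₗ[Λ] G, α.comp g = f) [Module.Finite Λ M]
    {b : ℕ} (hb : Module.length R (stableHom R Λ M (M × G)) ≤ b) :
    ∃ p : (Fin b → Λ) →ₗ[Λ] M, Function.Surjective p := by
  obtain ⟨v, hv⟩ := exists_generators (R := R) hM hproj hsimple hS hlift b ⊥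
    ((Module.length_le_of_injective (Submodule.subtype _) (Submodule.subtype_injective _)).trans hb)
  refine ⟨Fintype.linearCombination Λ v, LinearMap.range_eq_top.1 ?_⟩
  rw [Fintype.range_linearCombination, ← hv, bot_sup_eq]

lemma exists_not_factorsThroughProjective (R : Type u) [CommRing R] [IsLocalRing R]
    [IsNoetherianRing R] [IsAdicComplete (maximalIdeal R) R] [Algebra R Λ] [Module R M]
    [IsScalarTower R Λ M] [Module.Finite R M] (hM : IsIndecomposable Λ M)
    (hproj : ¬ Module.Projective Λ M) (hsimple : ∀ i, IsSimpleModule Λ (Sfam i))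
    (hS : ∀ (T : Type u) (_ : AddCommGroup T) (_ : Module Λ T),
      IsSimpleModule Λ T → ∃ i, Nonempty (T ≃ₗ[Λ] Sfam i))
    {α : G →ₗ[Λ] ∀ i, Sfam i}
    (hlift : ∀ f : M →ₗ[Λ] (∀ i, Sfam i), ∃ g : M →ₗ[Λ] G, α.comp g = f) [Module.Finite Λ M] :
    ∃ g : M →ₗ[Λ] G, ¬ FactorsThroughProjective Λ g := by
  classical
  have := hM.1
  obtain ⟨i, q, hq, -⟩ := exists_surjective_simple hS (bot_ne_top (α := Submodule Λ M))
  obtain ⟨g, hg⟩ := hlift ((LinearMap.single Λ Sfam i).comp q)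
  refine ⟨g, fun h => ?_⟩
  have := hM.eq_zero_of_factorsThroughProjective R hproj (h.postcomp ((LinearMap.proj i).comp α))
  have hq0 : q = 0 := by
    rw [← this, LinearMap.comp_assoc, hg]
    ext m
    simp
  have := IsSimpleModule.nontrivial Λ (Sfam i)
  obtain ⟨s, hs⟩ := exists_ne (0 : Sfam i)
  obtain ⟨m, rfl⟩ := hq s
  exact hs (by rw [hq0]; rfl)

lemma IsIndecomposable.exists_surjective_of_projective (R : Type u) [CommRing R] [IsLocalRing R]
    [IsNoetherianRing R] [IsAdicComplete (maximalIdeal R) R] [Algebra R Λ] [Module R M]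
    [IsScalarTower R Λ M] [Module.Finite R M] (hM : IsIndecomposable Λ M) [Module.Projective Λ M]
    {T : Type u} [AddCommGroup T] [Module Λ T] [IsSimpleModule Λ T] {q : M →ₗ[Λ] T}
    (hq : Function.Surjective q) : ∃ c : Λ →ₗ[Λ] M, Function.Surjective c := by
  have := IsSimpleModule.nontrivial Λ T
  obtain ⟨x, hx⟩ := exists_ne (0 : T)
  let s : Λ →ₗ[Λ] T := LinearMap.toSpanSingleton Λ T x
  have hs : s ≠ 0 := fun h => hx (by simpa [s] using LinearMap.congr_fun h 1)
  have hq0 : q ≠ 0 := by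
    rintro rfl
    obtain ⟨m, hm⟩ := hq x
    exact hx hm.symm
  obtain ⟨c, hc⟩ := Module.projective_lifting_property q s hq
  obtain ⟨a, ha⟩ := Module.projective_lifting_property s q (LinearMap.surjective_of_ne_zero hs)
  have := hM.bijective_of_comp_eq R hq0 (g := c.comp a) (by rw [← LinearMap.comp_assoc, hc, ha])
  exact ⟨c, Function.Surjective.of_comp this.2⟩

lemma IsIndecomposable.nonempty_equiv_of_projective (R : Type u) [CommRing R] [IsLocalRing R]
    [IsNoetherianRing R] [IsAdicComplete (maximalIdeal R) R] [Algebra R Λ] [Module R M]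
    [IsScalarTower R Λ M] [Module.Finite R M] (hM : IsIndecomposable Λ M) [Module.Projective Λ M]
    {M' : Type u} [AddCommGroup M'] [Module Λ M'] [Module R M'] [IsScalarTower R Λ M']
    [Module.Finite R M'] (hM' : IsIndecomposable Λ M') [Module.Projective Λ M']
    {T : Type u} [AddCommGroup T] [Module Λ T] [IsSimpleModule Λ T] {q : M →ₗ[Λ] T}
    (hq : Function.Surjective q) {q' : M' →ₗ[Λ] T} (hq' : Function.Surjective q') :
    Nonempty (M ≃ₗ[Λ] M') := by
  have := IsSimpleModule.nontrivial Λ T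
  obtain ⟨x, hx⟩ := exists_ne (0 : T)
  have hq0 : q ≠ 0 := by
    rintro rfl
    obtain ⟨m, hm⟩ := hq x
    exact hx hm.symm
  have hq0' : q' ≠ 0 := by
    rintro rfl
    obtain ⟨m, hm⟩ := hq' x
    exact hx hm.symm
  obtain ⟨a, ha⟩ := Module.projective_lifting_property q' q hq'
  obtain ⟨c, hc⟩ := Module.projective_lifting_property q q' hq
  have h₁ := hM.bijective_of_comp_eq R hq0 (g := c.comp a) (by rw [← LinearMap.comp_assoc, hc, ha])
  have h₂ := hM'.bijective_of_comp_eq R hq0' (g := a.comp c)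
    (by rw [← LinearMap.comp_assoc, ha, hc])
  exact ⟨LinearEquiv.ofBijective a ⟨Function.Injective.of_comp h₁.1,
    Function.Surjective.of_comp h₂.2⟩⟩

end Simples

section ReductionSequence

variable {R : Type u} [CommRing R] [IsLocalRing R] [IsNoetherianRing R]
  {Λ : Type u} [Ring Λ] [Algebra R Λ] [Module.Finite R Λ]
  {ω : Type u} [AddCommGroup ω] [Module R ω]

lemma exists_isReductionSequence {d : ℕ} (hd : ringKrullDim R = d) (hΛ : IsLattice R Λ ω Λ)
    {b : ℕ} (hb : 0 < b)
    (hP : ∀ N : IndecLat R Λ ω, ∀ r ∈ maximalIdeal R ^ b,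
      FactorsThroughProjective Λ (r • (LinearMap.id : N.X →ₗ[Λ] N.X)))
    (hgen : ∀ N : IndecLat R Λ ω, ∃ p : (Fin b → Λ) →ₗ[Λ] N.X, Function.Surjective p) :
    ∃ xs B, IsReductionSequence R Λ ω xs B := by
  obtain ⟨_, _, hdepth, -⟩ := (isLattice_iff hd).1 hΛ
  obtain ⟨xs, hlen, hpow, hreg, -, hdim⟩ := exists_wReg (Λ := Λ) hdepth hb le_rfl
  have hdim' : Module.supportDim R (Λ ⧸ redSub Λ xs Λ) ≤ 0 := by
    have h := hdim.trans ((Module.supportDim_le_ringKrullDim R Λ).trans hd.le)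
    induction hs : Module.supportDim R (Λ ⧸ redSub Λ xs Λ) with
    | bot => exact bot_le
    | coe a =>
      rw [hs] at h
      induction a with
      | top => exact absurd h (by exact_mod_cast (by simp))
      | coe a =>
        have h' : a + d ≤ d := by exact_mod_cast h
        have : a = 0 := by omega
        simp [this]
  have := finite_quotient (R := R) (redSub Λ xs Λ)
  have hfl := isFiniteLength_of_supportDim_le_zero hdim'
  obtain ⟨B, hB⟩ := ENat.ne_top_iff_exists.1
    (show Module.length R (Fin b → Λ ⧸ redSub Λ xs Λ) ≠ ⊤ by
      obtain ⟨_, _⟩ := isFiniteLength_iff_isNoetherian_isArtinian.1 hfl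
      exact Module.length_ne_top)
  refine ⟨xs, B, ?_, ?_, ?_, ?_⟩
  · intro x hx
    obtain ⟨y, hy, rfl⟩ := hpow x hx
    exact Ideal.pow_mem_of_mem _ hy b hb
  · intro N x hx
    obtain ⟨y, hy, rfl⟩ := hpow x hx
    exact hP N _ (Ideal.pow_mem_pow hy b)
  · intro N
    have := N.finite
    obtain ⟨_, _, hN, -⟩ := (isLattice_iff hd).1 N.lat
    exact (wReg_of_wReg hN (fun y hy => hP N _ (Ideal.pow_mem_pow hy b)) hlen.le hreg).1
  · intro N
    obtain ⟨p, hp⟩ := hgen N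
    exact (length_quotient_redSub_le p hp xs).trans hB.ge

end ReductionSequence

section Decomposition

open TensorProduct

lemma finrank_residueField_tensor_pos (R : Type u) [CommRing R] [IsLocalRing R] (A : Type u)
    [AddCommGroup A] [Module R A] [Module.Finite R A] [Nontrivial A] :
    0 < Module.finrank (ResidueField R) (ResidueField R ⊗[R] A) := by
  have : Nontrivial (ResidueField R ⊗[R] A) := by
    rw [← not_subsingleton_iff_nontrivial, IsLocalRing.subsingleton_tensorProduct]
    exact not_subsingleton A
  exact Module.finrank_pos

variable {R : Type u} [CommRing R] [IsLocalRing R] [IsNoetherianRing R]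
  {Λ : Type u} [Ring Λ] [Algebra R Λ] [Module.Finite R Λ]
variable {ω : Type u} [AddCommGroup ω] [Module R ω]

/-- Decomposition of lattices into indecomposable ones. -/
lemma IsLattice.exists_decomposition {d : ℕ} (hd : ringKrullDim R = d) {X : Type u}
    [AddCommGroup X] [Module Λ X] [Module R X] [IsScalarTower R Λ X] (hX : IsLattice R Λ ω X) :
    ∃ (κ : Type) (_ : Fintype κ) (N : κ → IndecLat R Λ ω) (a : ∀ j, (N j).X →ₗ[Λ] X)
      (c : ∀ j, X →ₗ[Λ] (N j).X), ∑ j, (a j).comp (c j) = LinearMap.id := by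
  induction hn : Module.finrank (ResidueField R) (ResidueField R ⊗[R] X)
    using Nat.strong_induction_on generalizing X with
  | _ n ih =>
  obtain ⟨_, _, -⟩ := (isLattice_iff hd).1 hX
  have : Module.Finite R X := Module.Finite.trans (R := R) Λ X
  by_cases hind : IsIndecomposable Λ X
  · exact ⟨Unit, inferInstance, fun _ => ⟨X, hX, hind⟩, fun _ => LinearMap.id,
      fun _ => LinearMap.id, by simp⟩
  obtain ⟨A, C, hAC, hA, hC⟩ : ∃ A C : Submodule Λ X, IsCompl A C ∧ A ≠ ⊥ ∧ C ≠ ⊥ := by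
    by_contra! h
    exact hind ⟨inferInstance, fun A C hAC => or_iff_not_imp_left.2 (h A C hAC)⟩
  have := Submodule.nontrivial_iff_ne_bot.2 hA
  have := Submodule.nontrivial_iff_ne_bot.2 hC
  let e := Submodule.prodEquivOfIsCompl A C hAC
  let pA : X →ₗ[Λ] A := (LinearMap.fst Λ A C).comp e.symm.toLinearMap
  let pC : X →ₗ[Λ] C := (LinearMap.snd Λ A C).comp e.symm.toLinearMap
  have hpA (x : A) : pA (A.subtype x) = x := by simp [pA, e]
  have hpC (x : C) : pC (C.subtype x) = x := by simp [pC, e]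
  have hsum : A.subtype.comp pA + C.subtype.comp pC = LinearMap.id := by
    ext x
    exact e.apply_symm_apply x
  have hfA : Module.Finite R A := Module.Finite.of_surjective (pA.restrictScalars R)
    fun x => ⟨_, hpA x⟩
  have hfC : Module.Finite R C := Module.Finite.of_surjective (pC.restrictScalars R)
    fun x => ⟨_, hpC x⟩
  have hfin : Module.finrank (ResidueField R) (ResidueField R ⊗[R] A) +
      Module.finrank (ResidueField R) (ResidueField R ⊗[R] C) = n := by
    rw [← hn, ← Module.finrank_prod]
    exact LinearEquiv.finrank_eq ((TensorProduct.prodRight R (ResidueField R) (ResidueField R)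
      A C).symm.trans (AlgebraTensorModule.congr (.refl _ _) (e.restrictScalars R)))
  have h₁ := finrank_residueField_tensor_pos R A
  have h₂ := finrank_residueField_tensor_pos R C
  obtain ⟨κ, _, N, a, c, h⟩ := ih _ (by omega) (hX.of_retract hd A.subtype pA hpA) rfl
  obtain ⟨κ', _, N', a', c', h'⟩ := ih _ (by omega) (hX.of_retract hd C.subtype pC hpC) rfl
  refine ⟨κ ⊕ κ', inferInstance, Sum.elim N N',
    Sum.rec (fun j => A.subtype.comp (a j)) (fun j => C.subtype.comp (a' j)),
    Sum.rec (fun j => (c j).comp pA) (fun j => (c' j).comp pC), ?_⟩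
  rw [Fintype.sum_sum_type, ← hsum]
  congr 1
  · ext x
    have h₁ := congrArg A.subtype (LinearMap.congr_fun h (pA x))
    rw [LinearMap.sum_apply, map_sum] at h₁
    exact (LinearMap.sum_apply _ _ _).trans h₁
  · ext x
    have h₁ := congrArg C.subtype (LinearMap.congr_fun h' (pC x))
    rw [LinearMap.sum_apply, map_sum] at h₁
    exact (LinearMap.sum_apply _ _ _).trans h₁

end Decomposition

section AlmostSplit

variable {R : Type u} [CommRing R] [IsLocalRing R] [IsNoetherianRing R]
  [IsAdicComplete (maximalIdeal R) R]
  {Λ : Type u} [Ring Λ] [Algebra R Λ] [Module.Finite R Λ]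
variable {ω : Type u} [AddCommGroup ω] [Module R ω] {xs : List R} {B : ℕ}

lemma exists_not_extendable_component {d : ℕ} (hd : ringKrullDim R = d) {K P Z : Type u}
    [AddCommGroup K] [Module Λ K] [AddCommGroup P] [Module Λ P]
    [AddCommGroup Z] [Module Λ Z] [Module R Z] [IsScalarTower R Λ Z] (hZ : IsLattice R Λ ω Z)
    {i : K →ₗ[Λ] P} {f : K →ₗ[Λ] Z} (hf : ¬ ∃ v : P →ₗ[Λ] Z, v.comp i = f) :
    ∃ (N : IndecLat R Λ ω) (c : Z →ₗ[Λ] N.X), ¬ ∃ v : P →ₗ[Λ] N.X, v.comp i = c.comp f := by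
  by_contra! h
  obtain ⟨κ, _, N, a, c, hac⟩ := hZ.exists_decomposition hd
  choose v hv using fun j => h (N j) (c j)
  refine hf ⟨∑ j, (a j).comp (v j), LinearMap.ext fun k => ?_⟩
  have h₁ (j : κ) : v j (i k) = c j (f k) := LinearMap.congr_fun (hv j) k
  have h₂ := LinearMap.congr_fun hac (f k)
  simpa [h₁, LinearMap.sum_apply] using h₂

/-- Pushing a non-extendable map along as far as possible. -/
lemma IsReductionSequence.exists_maximal_not_extendable {d : ℕ} (hd : ringKrullDim R = d)
    (H : IsReductionSequence R Λ ω xs B) (L : IndecLat R Λ ω) {K P : Type u}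
    [AddCommGroup K] [Module Λ K] [Module R K] [IsScalarTower R Λ K]
    [AddCommGroup P] [Module Λ P] [Module R P] [IsScalarTower R Λ P] [Module.Projective Λ P]
    (hK : IsLattice R Λ ω K) {i : K →ₗ[Λ] P} {q : P →ₗ[Λ] L.X}
    (hi : Function.Injective i) (hq : Function.Surjective q) (hiq : Function.Exact i q)
    (hid : ¬ ∃ v : P →ₗ[Λ] K, v.comp i = LinearMap.id) :
    ∃ (Y : IndecLat R Λ ω) (u : K →ₗ[Λ] Y.X), (¬ ∃ v : P →ₗ[Λ] Y.X, v.comp i = u) ∧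
      ∀ (Z : Type u) (_ : AddCommGroup Z) (_ : Module Λ Z) (_ : Module R Z)
        (_ : IsScalarTower R Λ Z), IsLattice R Λ ω Z → ∀ h : Y.X →ₗ[Λ] Z,
        (¬ ∃ r : Z →ₗ[Λ] Y.X, r.comp h = LinearMap.id) → ∃ v : P →ₗ[Λ] Z, v.comp i = h.comp u := by
  by_contra! hmax
  obtain ⟨Y₀, u₀, hu₀⟩ := exists_not_extendable_component hd hK hid
  have step (Y : IndecLat R Λ ω) (u : K →ₗ[Λ] Y.X) (hu : ¬ ∃ v : P →ₗ[Λ] Y.X, v.comp i = u) :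
      ∃ (N : IndecLat R Λ ω) (g : Y.X →ₗ[Λ] N.X), ¬ Function.Bijective g ∧
        ¬ ∃ v : P →ₗ[Λ] N.X, v.comp i = g.comp u := by
    obtain ⟨Z, _, _, _, _, hZ, h, hr, hv⟩ := hmax Y u (fun v hv => hu ⟨v, hv⟩)
    obtain ⟨N, c, hN⟩ := exists_not_extendable_component hd hZ (fun ⟨v, h⟩ => hv v h)
    refine ⟨N, c.comp h, fun hb => ?_, hN⟩
    let e := LinearEquiv.ofBijective _ hb
    exact hr (e.symm.toLinearMap.comp c) (LinearMap.ext fun y => e.symm_apply_apply y)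
  have chain (n : ℕ) : ∀ (Y : IndecLat R Λ ω) (u : K →ₗ[Λ] Y.X),
      (¬ ∃ v : P →ₗ[Λ] Y.X, v.comp i = u) → ∃ (N : IndecLat R Λ ω) (f : Y.X →ₗ[Λ] N.X),
        NonIsoChain n Y N f ∧ ¬ ∃ v : P →ₗ[Λ] N.X, v.comp i = f.comp u := by
    induction n with
    | zero => exact fun Y u hu => ⟨Y, LinearMap.id, trivial, hu⟩
    | succ n ih =>
      intro Y u hu
      obtain ⟨N, g, hg, hgu⟩ := step Y u hu
      obtain ⟨N', f, hf, hfu⟩ := ih N _ hgu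
      exact ⟨N', f.comp g, ⟨N, g, f, hg, hf, rfl⟩, by rwa [LinearMap.comp_assoc]⟩
  obtain ⟨N, f, hf, hfu⟩ := chain (haradaSaiBound B) Y₀ _ hu₀
  exact hfu (exists_extension_of_range_le_redSub i q hi hq hiq (H.factors L) (H.wReg N) _
    fun k => H.mem_redSub f hf _)

lemma nonIsoChain_pow {L : IndecLat R Λ ω} {c : Module.End Λ L.X} (hc : ¬ Function.Bijective c)
    (n : ℕ) : NonIsoChain n L L (c ^ n) := by
  induction n with
  | zero => trivial
  | succ n ih => exact ⟨L, c, c ^ n, hc, ih, pow_succ c n⟩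

lemma IsReductionSequence.factorsThroughProjective (H : IsReductionSequence R Λ ω xs B)
    {M N : IndecLat R Λ ω} {f : M.X →ₗ[Λ] N.X} (hf : NonIsoChain (haradaSaiBound B) M N f) :
    FactorsThroughProjective Λ f :=
  .of_range_le_redSub (H.factors M) (H.wReg N) f (H.mem_redSub f hf)

lemma bijective_of_comp_bijective {L M : IndecLat R Λ ω} {s : L.X →ₗ[Λ] M.X} {g : M.X →ₗ[Λ] L.X}
    (h : Function.Bijective (g.comp s)) : Function.Bijective g := by
  have := M.finite
  refine ⟨?_, Function.Surjective.of_comp h.2⟩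
  let e := LinearEquiv.ofBijective _ h
  let p : Module.End Λ M.X := s.comp (e.symm.toLinearMap.comp g)
  have he (l : L.X) : e.symm (g (s l)) = l := e.symm_apply_apply l
  have hp : IsIdempotentElem p := LinearMap.ext fun m => by
    show s (e.symm (g (s (e.symm (g m))))) = s (e.symm (g m))
    rw [he]
  rcases eq_zero_or_eq_one_of_isIdempotentElem M.indec hp with h₀ | h₁
  · have := L.indec.1
    obtain ⟨l, hl⟩ := exists_ne (0 : L.X)
    have h₂ : g (p (s l)) = g (s l) := congrArg (fun x => g (s x)) (he l)
    rw [h₀, LinearMap.zero_apply, map_zero] at h₂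
    exact absurd (h.1 (a₁ := l) (a₂ := 0) (by simp [← h₂])) hl
  · intro x y hxy
    have h₂ : p x = p y := congrArg (fun z => s (e.symm z)) hxy
    rwa [h₁] at h₂

end AlmostSplit

section AlmostSplitSequences

variable {R : Type u} [CommRing R] [IsLocalRing R] [IsNoetherianRing R]
  [IsAdicComplete (maximalIdeal R) R]
  {Λ : Type u} [Ring Λ] [Algebra R Λ] [Module.Finite R Λ]
variable {ω : Type u} [AddCommGroup ω] [Module R ω] {xs : List R} {B : ℕ}

/-- A non-projective indecomposable lattice `L` has a right almost split map `π : E → L`. -/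
lemma IsReductionSequence.exists_rightAlmostSplit {d : ℕ} (hd : ringKrullDim R = d)
    (hΛ : IsLattice R Λ ω Λ) (H : IsReductionSequence R Λ ω xs B) (L : IndecLat R Λ ω)
    (hL : ¬ Module.Projective Λ L.X) :
    ∃ (E : Type u) (_ : AddCommGroup E) (_ : Module Λ E) (_ : Module R E)
      (_ : IsScalarTower R Λ E) (π : E →ₗ[Λ] L.X), IsLattice R Λ ω E ∧
      (¬ ∃ s : L.X →ₗ[Λ] E, π.comp s = LinearMap.id) ∧
      ∀ (M : IndecLat R Λ ω) (g : M.X →ₗ[Λ] L.X), ¬ Function.Bijective g →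
        ∃ g' : M.X →ₗ[Λ] E, π.comp g' = g := by
  obtain ⟨n, q, hq, hP⟩ := IsLattice.exists_presentation hd hΛ L.lat
  let i := (LinearMap.ker q).subtype
  have hi : Function.Injective i := Submodule.subtype_injective _
  have hiq : Function.Exact i q := LinearMap.exact_subtype_ker_map q
  have hqi (k) : q (i k) = 0 := hiq.apply_apply_eq_zero k
  have : Nontrivial (LinearMap.ker q) := by
    rw [Submodule.nontrivial_iff_ne_bot]
    intro h
    exact hL (Module.Projective.of_equiv (LinearEquiv.ofBijective q ⟨LinearMap.ker_eq_bot.1 h, hq⟩))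
  have hid : ¬ ∃ v : (Fin n → Λ) →ₗ[Λ] LinearMap.ker q, v.comp i = LinearMap.id := by
    rintro ⟨v, hv⟩
    have hv' (k) : v (i k) = k := LinearMap.congr_fun hv k
    obtain ⟨s, hs⟩ := exists_factor_of_ker_le hq (LinearMap.id - i.comp v) fun p hp => by
      obtain ⟨k, rfl⟩ := (hiq p).1 hp
      simp [hv']
    refine hL (Module.Projective.of_split s q (LinearMap.ext fun l => ?_))
    obtain ⟨p, rfl⟩ := hq l
    have := congrArg q (LinearMap.congr_fun hs p)
    simpa [hqi] using this
  obtain ⟨Y, u, hu, hmax⟩ := H.exists_maximal_not_extendable hd L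
    (IsLattice.of_kernel hd i q hi hq hiq hP L.lat) hi hq hiq hid
  obtain ⟨E, _, _, _, _, θ, π, p, hθ, hπ, hθπ, e₁, e₂, hφ⟩ := exists_pushout (R := R) hi hq hiq u
  have hπθ (y) : π (θ y) = 0 := hθπ.apply_apply_eq_zero y
  have hpi (k) : p (i k) = θ (u k) := LinearMap.congr_fun e₁ k
  have hπp (x) : π (p x) = q x := LinearMap.congr_fun e₂ x
  have hE : IsLattice R Λ ω E := IsLattice.of_extension hd θ π hθ hπ hθπ Y.lat L.lat
  refine ⟨E, _, _, _, _, π, hE, ?_, fun M g hg => ?_⟩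
  · rintro ⟨s, hs⟩
    obtain ⟨r, hr⟩ := exists_retraction_of_section hθ hθπ s hs
    exact hu ⟨r.comp p, by rw [LinearMap.comp_assoc, e₁, ← LinearMap.comp_assoc, hr,
      LinearMap.id_comp]⟩
  let F : Submodule Λ (E × M.X) :=
    LinearMap.ker (π.comp (LinearMap.fst Λ E M.X) - g.comp (LinearMap.snd Λ E M.X))
  have hF (z : F) : π z.1.1 = g z.1.2 := sub_eq_zero.1 z.2
  let θ' : Y.X →ₗ[Λ] F := (LinearMap.inl Λ E M.X ∘ₗ θ).codRestrict F fun y => by simp [F, hπθ]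
  let π₁ : F →ₗ[Λ] E := (LinearMap.fst Λ E M.X).comp F.subtype
  let π₂ : F →ₗ[Λ] M.X := (LinearMap.snd Λ E M.X).comp F.subtype
  have hπ₁ (y) : π₁ (θ' y) = θ y := rfl
  have hππ (z) : π (π₁ z) = g (π₂ z) := hF z
  have hθ' : Function.Injective θ' := fun x y hxy => hθ (congrArg π₁ hxy)
  have hπ₂ : Function.Surjective π₂ := fun m => by
    obtain ⟨e, he⟩ := hπ (g m)
    exact ⟨⟨(e, m), sub_eq_zero.2 he⟩, rfl⟩
  have hexact : Function.Exact θ' π₂ := by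
    intro z
    constructor
    · intro hz
      obtain ⟨y, hy⟩ := (hθπ (π₁ z)).1 (by rw [hππ, hz, map_zero])
      exact ⟨y, Subtype.ext (Prod.ext hy hz.symm)⟩
    · rintro ⟨y, rfl⟩
      rfl
  have hFlat : IsLattice R Λ ω F := IsLattice.of_extension hd θ' π₂ hθ' hπ₂ hexact Y.lat M.lat
  by_cases hsplit : ∃ r : F →ₗ[Λ] Y.X, r.comp θ' = LinearMap.id
  · obtain ⟨r, hr⟩ := hsplit
    have hr' (y) : r (θ' y) = y := LinearMap.congr_fun hr y
    obtain ⟨g', hg'⟩ := exists_factor_of_ker_le hπ₂ (π₁ - θ.comp r) fun z hz => by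
      obtain ⟨y, rfl⟩ := (hexact z).1 hz
      simp [hr', hπ₁]
    refine ⟨g', LinearMap.ext fun m => ?_⟩
    obtain ⟨z, rfl⟩ := hπ₂ m
    have := congrArg π (LinearMap.congr_fun hg' z)
    simpa [hπθ, hππ] using this
  exfalso
  obtain ⟨v, hv⟩ := hmax F _ _ _ _ hFlat θ' hsplit
  have hv' (k) : v (i k) = θ' (u k) := LinearMap.congr_fun hv k
  obtain ⟨s, hs⟩ := exists_factor_of_ker_le hq (π₂.comp v) fun x hx => by
    obtain ⟨k, rfl⟩ := (hiq x).1 hx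
    rw [LinearMap.comp_apply, hv']
    exact hexact.apply_apply_eq_zero _
  have hs' (x) : s (q x) = π₂ (v x) := LinearMap.congr_fun hs x
  obtain ⟨φ, hφθ, hφp⟩ := hφ (π₁.comp v) (LinearMap.ext fun k => congrArg π₁ (hv' k))
  let c : Module.End Λ L.X := g.comp s
  have hcq (x) : c (q x) = π (π₁ (v x)) := by rw [hππ, ← hs']; rfl
  have hφc (z : E) : π (φ z) = c (π z) := by
    obtain ⟨x, hx⟩ := hq (π z)
    obtain ⟨y, hy⟩ := (hθπ (z - p x)).1 (by rw [map_sub, hπp, hx, sub_self])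
    have h₁ : φ z = θ y + π₁ (v x) := by
      rw [← sub_add_cancel z (p x), ← hy, map_add]
      exact congrArg₂ _ (LinearMap.congr_fun hφθ y) (LinearMap.congr_fun hφp x)
    rw [h₁, map_add, hπθ, zero_add, ← hx, hcq]
  have hc : ¬ Function.Bijective c := fun h => hg (bijective_of_comp_bijective h)
  obtain ⟨t, -, ht⟩ := (H.factorsThroughProjective
    (nonIsoChain_pow hc (haradaSaiBound B))).lift π hπ
  have key (m : ℕ) : ∃ w : (Fin n → Λ) →ₗ[Λ] E, w.comp i = θ.comp u ∧
      ∀ x, π (w x) = (c ^ m) (q x) := by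
    induction m with
    | zero => exact ⟨p, e₁, hπp⟩
    | succ m ih =>
      obtain ⟨w, hw, hw'⟩ := ih
      refine ⟨φ.comp w, by rw [LinearMap.comp_assoc, hw, ← LinearMap.comp_assoc, hφθ], fun x => ?_⟩
      rw [LinearMap.comp_apply, hφc, hw', pow_succ']
      rfl
  obtain ⟨w, hw, hw'⟩ := key (haradaSaiBound B)
  obtain ⟨ρ, hρ⟩ := exists_factor_of_range_le hθ (w - t.comp q) fun x => by
    refine (hθπ _).1 ?_
    have : π (t (q x)) = (c ^ haradaSaiBound B) (q x) := LinearMap.congr_fun ht (q x)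
    simp [hw', this]
  refine hu ⟨ρ, LinearMap.ext fun k => hθ ?_⟩
  have h₁ := LinearMap.congr_fun hρ (i k)
  have h₂ : w (i k) = θ (u k) := LinearMap.congr_fun hw k
  simpa [hqi, h₂] using h₁

/-- Up to isomorphism only finitely many indecomposable lattices admit a stably nonzero map to `L`
whose composite with a long chain of non-isomorphisms is stably nonzero. -/
lemma IsReductionSequence.exists_list {d : ℕ} (hd : ringKrullDim R = d)
    (hΛ : IsLattice R Λ ω Λ) (H : IsReductionSequence R Λ ω xs B) (k j : ℕ)
    (hjk : j + k = haradaSaiBound B) (L T : IndecLat R Λ ω) (t : L.X →ₗ[Λ] T.X)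
    (ht : NonIsoChain j L T t) :
    ∃ l : List (IndecLat R Λ ω), ∀ (M : IndecLat R Λ ω) (g : M.X →ₗ[Λ] L.X),
      ¬ FactorsThroughProjective Λ (t.comp g) → ∃ N ∈ l, Nonempty (M.X ≃ₗ[Λ] N.X) := by
  classical
  induction k generalizing j L with
  | zero =>
    rw [add_zero] at hjk
    subst hjk
    exact ⟨[], fun M g hg => (hg ((H.factorsThroughProjective ht).precomp g)).elim⟩
  | succ k ih =>
    by_cases hL : Module.Projective Λ L.X
    · exact ⟨[], fun M g hg => (hg ((FactorsThroughProjective.of_projective_left t).precomp g)).elim⟩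
    obtain ⟨E, _, _, _, _, π, hE, hsplit, hfac⟩ := H.exists_rightAlmostSplit hd hΛ L hL
    obtain ⟨κ, _, N, a, c, hac⟩ := hE.exists_decomposition hd
    have hbij (y : κ) : ¬ Function.Bijective (π.comp (a y)) := fun h =>
      hsplit ⟨(a y).comp (LinearEquiv.ofBijective _ h).symm.toLinearMap,
        LinearMap.ext fun l => (LinearEquiv.ofBijective _ h).apply_symm_apply l⟩
    choose l hl using fun y => ih (j + 1) (by omega) (N y) (t.comp (π.comp (a y)))
      ⟨L, _, t, hbij y, ht, rfl⟩
    refine ⟨L :: (Finset.univ.toList.flatMap l), fun M g hg => ?_⟩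
    by_cases hgb : Function.Bijective g
    · exact ⟨L, by simp, ⟨LinearEquiv.ofBijective g hgb⟩⟩
    obtain ⟨g', rfl⟩ := hfac M g hgb
    obtain ⟨y, hy⟩ : ∃ y, ¬ FactorsThroughProjective Λ
        ((t.comp (π.comp (a y))).comp ((c y).comp g')) := by
      by_contra! h
      refine hg ?_
      have := FactorsThroughProjective.sum Finset.univ _ fun y _ => h y
      convert this using 1
      ext m
      have h₁ := congrArg (fun e => t (π e)) (LinearMap.congr_fun hac (g' m))
      simpa [LinearMap.sum_apply] using h₁.symm
    obtain ⟨X, hX, e⟩ := hl y M _ hy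
    exact ⟨X, by simp only [List.mem_cons, List.mem_flatMap]; exact .inr ⟨y, by simp, hX⟩, e⟩

end AlmostSplitSequences

section FiniteType

variable {R : Type u} [CommRing R] [IsLocalRing R] [IsNoetherianRing R]
  [IsAdicComplete (maximalIdeal R) R]
  {Λ : Type u} [Ring Λ] [Algebra R Λ] [Module.Finite R Λ]
variable {ω : Type u} [AddCommGroup ω] [Module R ω]

/-- Finitely many indecomposable lattices admit a stably nonzero map to a given lattice. -/
lemma IsReductionSequence.exists_list_of_isLattice {xs : List R} {B : ℕ} {d : ℕ}
    (hd : ringKrullDim R = d) (hΛ : IsLattice R Λ ω Λ) (H : IsReductionSequence R Λ ω xs B)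
    {G : Type u} [AddCommGroup G] [Module Λ G] [Module R G] [IsScalarTower R Λ G]
    (hG : IsLattice R Λ ω G) :
    ∃ l : List (IndecLat R Λ ω), ∀ (M : IndecLat R Λ ω) (g : M.X →ₗ[Λ] G),
      ¬ FactorsThroughProjective Λ g → ∃ N ∈ l, Nonempty (M.X ≃ₗ[Λ] N.X) := by
  classical
  obtain ⟨κ, _, N, a, c, hac⟩ := hG.exists_decomposition hd
  choose l hl using fun y => H.exists_list hd hΛ _ 0 (zero_add _) (N y) (N y) LinearMap.id trivial
  refine ⟨Finset.univ.toList.flatMap l, fun M g hg => ?_⟩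
  obtain ⟨y, hy⟩ : ∃ y, ¬ FactorsThroughProjective Λ ((c y).comp g) := by
    by_contra! h
    refine hg ?_
    have := FactorsThroughProjective.sum Finset.univ _ fun y _ => (h y).postcomp (a y)
    convert this using 1
    ext m
    simpa [LinearMap.sum_apply] using (LinearMap.congr_fun hac (g m)).symm
  obtain ⟨X, hX, e⟩ := hl y M ((c y).comp g) hy
  exact ⟨X, List.mem_flatMap.2 ⟨y, by simp, hX⟩, e⟩

/-- There are finitely many indecomposable projective lattices. -/
lemma exists_list_projective {ι : Type u} [Fintype ι] {Sfam : ι → Type u}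
    [∀ i, AddCommGroup (Sfam i)] [∀ i, Module Λ (Sfam i)]
    (hsimple : ∀ i, IsSimpleModule Λ (Sfam i))
    (hS : ∀ (T : Type u) (_ : AddCommGroup T) (_ : Module Λ T),
      IsSimpleModule Λ T → ∃ i, Nonempty (T ≃ₗ[Λ] Sfam i)) :
    ∃ l : List (IndecLat R Λ ω), ∀ M : IndecLat R Λ ω, Module.Projective Λ M.X →
      ∃ N ∈ l, Nonempty (M.X ≃ₗ[Λ] N.X) := by
  classical
  have key (i : ι) : ∃ l : List (IndecLat R Λ ω), ∀ M : IndecLat R Λ ω, Module.Projective Λ M.X →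
      (∃ q : M.X →ₗ[Λ] Sfam i, Function.Surjective q) → ∃ N ∈ l, Nonempty (M.X ≃ₗ[Λ] N.X) := by
    by_cases h : ∃ N : IndecLat R Λ ω, Module.Projective Λ N.X ∧
        ∃ q : N.X →ₗ[Λ] Sfam i, Function.Surjective q
    · obtain ⟨N, hN, q', hq'⟩ := h
      refine ⟨[N], fun M hM ⟨q, hq⟩ => ⟨N, by simp, ?_⟩⟩
      have := M.finite
      have := N.finite
      exact M.indec.nonempty_equiv_of_projective R N.indec hq hq'
    · exact ⟨[], fun M hM hq => (h ⟨M, hM, hq⟩).elim⟩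
  choose l hl using key
  refine ⟨Finset.univ.toList.flatMap l, fun M hM => ?_⟩
  have := M.lat.1
  have := M.indec.1
  obtain ⟨i, q, hq, -⟩ := exists_surjective_simple hS (bot_ne_top (α := Submodule Λ M.X))
  obtain ⟨N, hN, e⟩ := hl i M hM ⟨q, hq⟩
  exact ⟨N, List.mem_flatMap.2 ⟨i, by simp, hN⟩, e⟩

end FiniteType

/-- **First Brauer–Thrall theorem for lattices.**
If the `R`-order `Λ` is of bounded lattice type, i.e. there is an integer
`b > 0` such that every indecomposable `Λ`-lattice `M` satisfies
`ℓ_R(h(M)) < b`, then `Λ` is of finite lattice type: there are only finitely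
many isomorphism classes of indecomposable `Λ`-lattices. -/
theorem finite_lat_type_of_bounded_lat_type
    (R : Type u) [CommRing R] [IsNoetherianRing R] [IsLocalRing R]
    [IsAdicComplete (maximalIdeal R) R]
    (d : ℕ) (hdim : ringKrullDim R = (d : WithBot ℕ∞))
    (hCM : IsMCM R R)
    (ω : Type u) [AddCommGroup ω] [Module R ω] (hω : IsCanonicalModule R ω)
    (Λ : Type u) [Ring Λ] [Algebra R Λ] [Module.Finite R Λ]
    (hord : IsLattice R Λ ω Λ)
    (ι : Type u) [Fintype ι] (Sfam : ι → Type u) [∀ i, AddCommGroup (Sfam i)]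
    [∀ i, Module Λ (Sfam i)]
    (G : Type u) [AddCommGroup G] [Module Λ G] [Module R G] [IsScalarTower R Λ G]
    (α : G →ₗ[Λ] ∀ i, Sfam i) (happrox : IsSimplesApprox R Λ ω ι Sfam G α)
    (b : ℕ) (hb : 0 < b)
    (hbound : ∀ (M : Type u) (_ : AddCommGroup M) (_ : Module Λ M) (_ : Module R M)
      (_ : IsScalarTower R Λ M), IsLattice R Λ ω M → IsIndecomposable Λ M →
        hLength R Λ M G < (b : WithBot ℕ∞)) :
    FiniteLatType R Λ ω := by
  obtain ⟨hsimple, -, hS, hα⟩ := happrox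
  have hlen (N : IndecLat R Λ ω) : Module.length R (stableHom R Λ N.X (N.X × G)) ≤ b :=
    length_stableHom_le (hbound N.X _ _ _ _ N.lat N.indec)
  have hlift (N : IndecLat R Λ ω) (f : N.X →ₗ[Λ] ∀ i, Sfam i) : ∃ g : N.X →ₗ[Λ] G, α.comp g = f :=
    hα.exists_lift hdim hord N.lat f
  have hgen (N : IndecLat R Λ ω) : ∃ p : (Fin b → Λ) →ₗ[Λ] N.X, Function.Surjective p := by
    have := N.finite
    have := N.lat.1
    by_cases hproj : Module.Projective Λ N.X
    · have := N.indec.1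
      obtain ⟨i, q, hq, -⟩ := exists_surjective_simple hS (bot_ne_top (α := Submodule Λ N.X))
      have := hsimple i
      obtain ⟨c, hc⟩ := N.indec.exists_surjective_of_projective R hq
      exact ⟨c.comp (LinearMap.proj ⟨0, hb⟩), hc.comp (LinearMap.proj_surjective _)⟩
    · exact exists_surjective_of_length_le N.indec hproj hsimple hS (hlift N) (hlen N)
  obtain ⟨xs, B, H⟩ := exists_isReductionSequence hdim hord hb
    (fun N r hr => factorsThroughProjective_smul_id (hlen N) hr) hgen
  obtain ⟨l₁, hl₁⟩ := H.exists_list_of_isLattice hdim hord hα.1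
  obtain ⟨l₂, hl₂⟩ := exists_list_projective (R := R) (ω := ω) hsimple hS
  refine ⟨(l₁ ++ l₂).length, fun i => ((l₁ ++ l₂).get i).X, inferInstance, inferInstance,
    fun M _ _ _ _ hM hind => ?_⟩
  let M' : IndecLat R Λ ω := ⟨M, hM, hind⟩
  have := M'.finite
  have := hM.1
  obtain ⟨N, hN, e⟩ : ∃ N ∈ l₁ ++ l₂, Nonempty (M'.X ≃ₗ[Λ] N.X) := by
    by_cases hproj : Module.Projective Λ M'.X
    · obtain ⟨N, hN, e⟩ := hl₂ M' hproj
      exact ⟨N, List.mem_append_right _ hN, e⟩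
    · obtain ⟨g, hg⟩ := exists_not_factorsThroughProjective R hind hproj hsimple hS (hlift M')
      obtain ⟨N, hN, e⟩ := hl₁ M' g hg
      exact ⟨N, List.mem_append_left _ hN, e⟩
  obtain ⟨i, rfl⟩ := List.get_of_mem hN
  exact ⟨i, e⟩

end BT
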